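/- arXiv:0707.1808 — 2 statements merged into one kernel-verified Lean document; each statement's English description precedes it below -/
import Mathlib

section
/- Let P = f·λ_d be a Borel probability measure on ℝ^d, let r > 0 with ∫ |x|^r dP(x) < ∞, and let (α_n)_{n≥1} be a sequence of finite codebooks such that ∫ d(x,α_n)^r dP(x) → 0 as n → ∞. Let θ > 0 and μ ∈ ℝ^d be such that (θ,μ) is P-admissible and hypotheses (H1) and (H3) hold. Then for every p ∈ (1,∞) and every b > 0: if f^{−p} is locally P-integrable then ψ_b^p is locally P_{θ,μ}-integrable. -/
open MeasureTheory ENNReal Filter Set Metric Topology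
open scoped Classical

noncomputable section

/-- Distance from a point `x` to a finite codebook `α`. -/
def qdist {d : ℕ} (x : EuclideanSpace ℝ (Fin d)) (α : Finset (EuclideanSpace ℝ (Fin d))) : ℝ :=
  Metric.infDist x (α : Set (EuclideanSpace ℝ (Fin d)))

/-- The `r`-th power `L^r` quantization error `∫ d(x,α)^r dP` of a codebook `α`. -/
def qerr {d : ℕ} (P : Measure (EuclideanSpace ℝ (Fin d))) (r : ℝ)
    (α : Finset (EuclideanSpace ℝ (Fin d))) : ℝ≥0∞ :=
  ∫⁻ x, ENNReal.ofReal (qdist x α) ^ r ∂P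

/-- The optimal `n`-level `L^r` quantization error `e_{n,r}(P)`. -/
def enr {d : ℕ} (P : Measure (EuclideanSpace ℝ (Fin d))) (r : ℝ) (n : ℕ) : ℝ≥0∞ :=
  ⨅ (α : Finset (EuclideanSpace ℝ (Fin d))) (_ : α.Nonempty) (_ : α.card ≤ n),
    qerr P r α ^ (1 / r)

/-- The uniform distribution on the unit cube `[0,1]^d`. -/
def unifCube (d : ℕ) : Measure (EuclideanSpace ℝ (Fin d)) :=
  volume.restrict {x | ∀ i, x i ∈ Icc (0 : ℝ) 1}

/-- The constant `J_{r,d} = inf_{n ≥ 1} n^{r/d} e_{n,r}(U([0,1]^d))^r`. -/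
def Jrd (r : ℝ) (d : ℕ) : ℝ≥0∞ :=
  ⨅ (n : ℕ) (_ : 1 ≤ n), (n : ℝ≥0∞) ^ (r / (d : ℝ)) * enr (unifCube d) r n ^ r

/-- Zador's constant `Q_r(P)` for a measure whose a.c. part has density `f`. -/
def Qr {d : ℕ} (f : EuclideanSpace ℝ (Fin d) → ℝ) (r : ℝ) : ℝ≥0∞ :=
  Jrd r d * (∫⁻ x, ENNReal.ofReal (f x) ^ ((d : ℝ) / ((d : ℝ) + r))) ^ (((d : ℝ) + r) / (d : ℝ))

/-- The dilated/contracted codebook `α^{θ,μ} = μ + θ(α - μ)`. -/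
def dilate {d : ℕ} (α : Finset (EuclideanSpace ℝ (Fin d))) (θ : ℝ)
    (μ : EuclideanSpace ℝ (Fin d)) : Finset (EuclideanSpace ℝ (Fin d)) :=
  α.image fun a => μ + θ • (a - μ)

/-- `f_{θ,μ}(x) = f(μ + θ(x-μ))`. -/
def fdil {d : ℕ} (f : EuclideanSpace ℝ (Fin d) → ℝ) (θ : ℝ)
    (μ x : EuclideanSpace ℝ (Fin d)) : ℝ :=
  f (μ + θ • (x - μ))

/-- The image measure `P_{θ,μ}` of `P` under `x ↦ (x-μ)/θ + μ`. -/
def Pdil {d : ℕ} (P : Measure (EuclideanSpace ℝ (Fin d))) (θ : ℝ)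
    (μ : EuclideanSpace ℝ (Fin d)) : Measure (EuclideanSpace ℝ (Fin d)) :=
  Measure.map (fun x => μ + θ⁻¹ • (x - μ)) P

/-- `(θ,μ)` is `P`-admissible for `P = f·λ_d`:
`{f>0} ⊆ μ(1-θ) + θ{f>0}` up to a `λ_d`-null set.  (Note that
`x ∈ μ(1-θ) + θ{f>0}` iff `f((x-μ)/θ + μ) > 0`.) -/
def Admissible {d : ℕ} (f : EuclideanSpace ℝ (Fin d) → ℝ) (θ : ℝ)
    (μ : EuclideanSpace ℝ (Fin d)) : Prop :=
  ∀ᵐ x ∂(volume : Measure (EuclideanSpace ℝ (Fin d))),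
    0 < f x → 0 < f (μ + θ⁻¹ • (x - μ))

/-- The maximal function `ψ_b` attached to `P` and the sequence of codebooks `α`. -/
def maxFun {d : ℕ} (P : Measure (EuclideanSpace ℝ (Fin d)))
    (α : ℕ → Finset (EuclideanSpace ℝ (Fin d))) (b : ℝ)
    (x : EuclideanSpace ℝ (Fin d)) : ℝ≥0∞ :=
  ⨆ (n : ℕ) (_ : 1 ≤ n),
    volume (Metric.ball x (b * qdist x (α n))) / P (Metric.ball x (b * qdist x (α n)))

/-- An `L^r(P)`-optimal sequence of `n`-quantizers. -/
def OptimalSeq {d : ℕ} (P : Measure (EuclideanSpace ℝ (Fin d))) (r : ℝ)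
    (α : ℕ → Finset (EuclideanSpace ℝ (Fin d))) : Prop :=
  ∀ n, 1 ≤ n → (α n).Nonempty ∧ (α n).card ≤ n ∧ qerr P r (α n) = enr P r n ^ r

/-- An asymptotically `L^r(P)`-optimal sequence of quantizers,
for `P` whose a.c. part has density `f`. -/
def AsympOptimalSeq {d : ℕ} (P : Measure (EuclideanSpace ℝ (Fin d)))
    (f : EuclideanSpace ℝ (Fin d) → ℝ) (r : ℝ)
    (α : ℕ → Finset (EuclideanSpace ℝ (Fin d))) : Prop :=
  (∀ n, 1 ≤ n → (α n).Nonempty ∧ (α n).card ≤ n) ∧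
  Tendsto (fun n : ℕ => (n : ℝ≥0∞) ^ (r / (d : ℝ)) * qerr P r (α n)) atTop (𝓝 (Qr f r))

/-- `L^s(P)`-rate-optimality of a sequence of codebooks. -/
def RateOptimal {d : ℕ} (P : Measure (EuclideanSpace ℝ (Fin d))) (s : ℝ)
    (β : ℕ → Finset (EuclideanSpace ℝ (Fin d))) : Prop :=
  limsup (fun n : ℕ => (n : ℝ≥0∞) ^ (s / (d : ℝ)) * qerr P s (β n)) atTop < ⊤

/-- The support of a measure. -/
def msupp {d : ℕ} (P : Measure (EuclideanSpace ℝ (Fin d))) : Set (EuclideanSpace ℝ (Fin d)) :=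
  {x | ∀ ε > 0, 0 < P (Metric.ball x ε)}

/-- Hypothesis (H1): for every `M > 0`,
`sup { f(μ+θ(z-μ))/f(z) : z ∈ B(0,M), f(z) > 0 } < ∞`. -/
def H1 {d : ℕ} (f : EuclideanSpace ℝ (Fin d) → ℝ) (θ : ℝ)
    (μ : EuclideanSpace ℝ (Fin d)) : Prop :=
  ∀ M > (0 : ℝ), ∃ C : ℝ, ∀ z ∈ Metric.ball (0 : EuclideanSpace ℝ (Fin d)) M,
    0 < f z → f (μ + θ • (z - μ)) / f z ≤ C

/-- Hypothesis (H2). -/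
def H2 {d : ℕ} (P : Measure (EuclideanSpace ℝ (Fin d))) (θ : ℝ)
    (μ : EuclideanSpace ℝ (Fin d)) (s r : ℝ) : Prop :=
  ∃ b ∈ Ioo (0 : ℝ) (1 / 2), ∃ M > (0 : ℝ),
    (∫⁻ x in {x : EuclideanSpace ℝ (Fin d) | M < ‖x‖},
      (⨆ t ∈ Ioc (0 : ℝ) (2 * b * ‖x‖),
        volume (Metric.ball x t) / P (Metric.ball x t)) ^ (s / ((d : ℝ) + r))
      ∂(Pdil P θ μ)) < ⊤

/-- Hypothesis (H3): `λ_d(· ∩ supp P) ≪ P` and `supp P` is a finite union of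
closed convex sets. -/
def H3 {d : ℕ} (P : Measure (EuclideanSpace ℝ (Fin d))) : Prop :=
  volume.restrict (msupp P) ≪ P ∧
  ∃ (k : ℕ) (C : Fin k → Set (EuclideanSpace ℝ (Fin d))),
    (∀ i, IsClosed (C i) ∧ Convex ℝ (C i)) ∧ msupp P = ⋃ i, C i

/-- Weak type bound for the centered maximal function of a measure `ν` relative to a measure `P`,
over balls of bounded radius, in a space with the Besicovitch covering property. -/
theorem mul_measure_setOf_exists_ball_le {E : Type*} [MetricSpace E]
    [SecondCountableTopology E] [MeasurableSpace E] [OpensMeasurableSpace E]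
    {N : ℕ} {τ : ℝ} (hτ : 1 < τ) (hN : IsEmpty (Besicovitch.SatelliteConfig E N τ))
    (P ν : Measure E) (c : ℝ≥0∞) (R : ℝ) :
    c * P {x | ∃ t, 0 < t ∧ t ≤ R ∧ c * P (ball x t) < ν (ball x t)} ≤ N * ν univ := by
  set A := {x | ∃ t, 0 < t ∧ t ≤ R ∧ c * P (ball x t) < ν (ball x t)} with hA
  have key : ∀ x : A, ∃ ρ, 0 < ρ ∧ ρ ≤ R ∧
      c * P (closedBall (x : E) ρ) ≤ ν (closedBall (x : E) ρ) := by
    rintro ⟨x, t, ht, htR, hlt⟩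
    obtain ⟨u, hu, hut, hlim⟩ := exists_seq_strictMono_tendsto' ht
    have hball : ball x t = ⋃ n, closedBall x (u n) := by
      ext y
      simp only [mem_ball, mem_iUnion, mem_closedBall]
      constructor
      · intro hy
        obtain ⟨n, hn⟩ := (hlim.eventually (lt_mem_nhds hy)).exists
        exact ⟨n, hn.le⟩
      · rintro ⟨n, hn⟩
        exact hn.trans_lt (hut n).2
    have hmono : Monotone fun n => closedBall x (u n) :=
      fun m n hmn => closedBall_subset_closedBall (hu.monotone hmn)
    have hsup : ν (ball x t) = ⨆ n, ν (closedBall x (u n)) := by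
      rw [hball, hmono.measure_iUnion]
    rw [hsup, lt_iSup_iff] at hlt
    obtain ⟨n, hn⟩ := hlt
    refine ⟨u n, (hut n).1, (hut n).2.le.trans htR, le_trans ?_ hn.le⟩
    gcongr
    exact closedBall_subset_ball (hut n).2
  choose ρ hρ0 hρR hρ using key
  let q : Besicovitch.BallPackage A E :=
    { c := fun x => x, r := ρ, rpos := hρ0, r_bound := R, r_le := hρR }
  obtain ⟨s, hdisj, hcov⟩ := Besicovitch.exist_disjoint_covering_families hτ hN q
  have hcount : ∀ i, (s i).Countable := fun i =>
    (hdisj i).countable_of_nonempty_interior fun j _ =>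
      ⟨j, ball_subset_interior_closedBall (mem_ball_self (hρ0 j))⟩
  have hAcov : A ⊆ ⋃ i : Fin N, ⋃ j ∈ s i, closedBall (j : E) (ρ j) := by
    intro x hx
    have := hcov ⟨⟨x, hx⟩, rfl⟩
    simp only [mem_iUnion] at this ⊢
    obtain ⟨i, j, hj, hxj⟩ := this
    exact ⟨i, j, hj, ball_subset_closedBall hxj⟩
  have hfam : ∀ i : Fin N, c * P (⋃ j ∈ s i, closedBall (j : E) (ρ j)) ≤ ν univ := by
    intro i
    have := (hcount i).to_subtype
    calc c * P (⋃ j ∈ s i, closedBall (j : E) (ρ j))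
        ≤ c * ∑' j : s i, P (closedBall (j : E) (ρ j)) := by
          gcongr
          exact measure_biUnion_le P (hcount i) _
      _ = ∑' j : s i, c * P (closedBall (j : E) (ρ j)) := ENNReal.tsum_mul_left.symm
      _ ≤ ∑' j : s i, ν (closedBall (j : E) (ρ j)) := ENNReal.tsum_le_tsum fun j => hρ j
      _ = ν (⋃ j ∈ s i, closedBall (j : E) (ρ j)) :=
          (measure_biUnion (hcount i) (hdisj i) fun _ _ => measurableSet_closedBall).symm
      _ ≤ ν univ := measure_mono (subset_univ _)
  calc c * P A ≤ c * ∑ i : Fin N, P (⋃ j ∈ s i, closedBall (j : E) (ρ j)) := by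
        gcongr
        exact (measure_mono hAcov).trans (measure_iUnion_fintype_le _ _)
    _ = ∑ i : Fin N, c * P (⋃ j ∈ s i, closedBall (j : E) (ρ j)) := Finset.mul_sum _ _ _
    _ ≤ ∑ _i : Fin N, ν univ := Finset.sum_le_sum fun i _ => hfam i
    _ = N * ν univ := by simp

/-- Truncated weak type bound for the centered maximal function of `g` with respect to `P`: only
the part of `g` above half the level contributes. -/
theorem mul_measure_lt_le_of_forall_exists_ball {E : Type*} [MetricSpace E]
    [SecondCountableTopology E] [MeasurableSpace E] [OpensMeasurableSpace E]
    {N : ℕ} {τ : ℝ} (hτ : 1 < τ) (hN : IsEmpty (Besicovitch.SatelliteConfig E N τ))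
    (P : Measure E) [IsFiniteMeasure P] {g : E → ℝ} (hg : Measurable g)
    {R : ℝ} {h : E → ℝ≥0∞}
    (hh : ∀ x s, s < h x → ∃ t, 0 < t ∧ t ≤ R ∧
      s * P (ball x t) < ∫⁻ y in ball x t, ENNReal.ofReal (g y) ∂P)
    {s : ℝ} (hs : 0 < s) :
    ENNReal.ofReal (s / 2) * P {x | ENNReal.ofReal s < h x} ≤
      N * (P.withDensity fun y => ENNReal.ofReal (g y)) {y | s < 2 * g y} := by
  set ν := P.withDensity fun y => ENNReal.ofReal (g y) with hν
  set S := {y | s < 2 * g y} with hS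
  have hSm : MeasurableSet S := measurableSet_lt measurable_const (hg.const_mul 2)
  have hsub : {x | ENNReal.ofReal s < h x} ⊆ {x | ∃ t, 0 < t ∧ t ≤ R ∧
      ENNReal.ofReal (s / 2) * P (ball x t) < ν.restrict S (ball x t)} := by
    intro x hx
    obtain ⟨t, ht, htR, hlt⟩ := hh x _ hx
    refine ⟨t, ht, htR, ?_⟩
    have hsplit : ∫⁻ y in ball x t, ENNReal.ofReal (g y) ∂P ≤
        ν.restrict S (ball x t) + ENNReal.ofReal (s / 2) * P (ball x t) := by
      have hb : MeasurableSet (ball x t) := measurableSet_ball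
      rw [Measure.restrict_apply hb, hν, withDensity_apply _ (hb.inter hSm),
        ← lintegral_inter_add_sdiff _ (ball x t) hSm]
      gcongr
      calc ∫⁻ y in ball x t \ S, ENNReal.ofReal (g y) ∂P
          ≤ ∫⁻ _ in ball x t \ S, ENNReal.ofReal (s / 2) ∂P := by
            refine setLIntegral_mono' (hb.diff hSm) fun y hy => ENNReal.ofReal_le_ofReal ?_
            have := hy.2
            simp only [hS, mem_ofPred_eq, not_lt] at this
            linarith
        _ = ENNReal.ofReal (s / 2) * P (ball x t \ S) := setLIntegral_const _ _
        _ ≤ ENNReal.ofReal (s / 2) * P (ball x t) := by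
            gcongr
            exact sdiff_subset
    have hs2 : ENNReal.ofReal s = ENNReal.ofReal (s / 2) + ENNReal.ofReal (s / 2) := by
      rw [← ENNReal.ofReal_add (by positivity) (by positivity), add_halves]
    rw [hs2, add_mul] at hlt
    exact (ENNReal.add_lt_add_iff_right
      (ENNReal.mul_ne_top ENNReal.ofReal_ne_top (measure_ne_top _ _))).1 (hlt.trans_le hsplit)
  calc ENNReal.ofReal (s / 2) * P {x | ENNReal.ofReal s < h x}
      ≤ ENNReal.ofReal (s / 2) * P {x | ∃ t, 0 < t ∧ t ≤ R ∧
          ENNReal.ofReal (s / 2) * P (ball x t) < ν.restrict S (ball x t)} := by gcongr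
    _ ≤ N * ν.restrict S univ := mul_measure_setOf_exists_ball_le hτ hN P _ _ R
    _ = N * ν S := by rw [Measure.restrict_apply_univ]

/-- Strong type bound: a function dominated by the centered maximal function of `g` with respect
to `P`, over balls of bounded radius, has finite `p`-th moment as soon as `g` does. -/
theorem lintegral_rpow_lt_top_of_forall_exists_ball {E : Type*} [MetricSpace E]
    [HasBesicovitchCovering E] [SecondCountableTopology E] [MeasurableSpace E]
    [OpensMeasurableSpace E] (P : Measure E) [IsFiniteMeasure P] {g : E → ℝ}
    (hg : Measurable g) (hg0 : ∀ x, 0 ≤ g x) {R : ℝ} {h : E → ℝ≥0∞}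
    (hh : ∀ x s, s < h x → ∃ t, 0 < t ∧ t ≤ R ∧
      s * P (ball x t) < ∫⁻ y in ball x t, ENNReal.ofReal (g y) ∂P)
    {p : ℝ} (hp : 1 < p) (hgp : ∫⁻ x, ENNReal.ofReal (g x) ^ p ∂P < ⊤) :
    ∫⁻ x, h x ^ p ∂P < ⊤ := by
  have hp0 : 0 < p := zero_lt_one.trans hp
  obtain ⟨N, τ, hτ, hN⟩ := HasBesicovitchCovering.no_satelliteConfig (α := E)
  set ν := P.withDensity fun y => ENNReal.ofReal (g y) with hν
  set B := ENNReal.ofReal p * ((2 * N) * ∫⁻ t in Ioi (0 : ℝ), ν {y | t < 2 * g y} *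
    ENNReal.ofReal (t ^ (p - 1 - 1))) with hB
  have hBfin : B < ⊤ := by
    have hcake := lintegral_rpow_eq_lintegral_meas_lt_mul ν (f := fun y => 2 * g y)
      (Eventually.of_forall fun y => mul_nonneg zero_le_two (hg0 y))
      (hg.const_mul 2).aemeasurable (sub_pos.2 hp)
    have hfin : ∫⁻ y, ENNReal.ofReal ((2 * g y) ^ (p - 1)) ∂ν < ⊤ := by
      rw [hν, lintegral_withDensity_eq_lintegral_mul _ hg.ennreal_ofReal
        ((hg.const_mul 2).pow_const _).ennreal_ofReal]
      have hpt : ∀ y, ENNReal.ofReal (g y) * ENNReal.ofReal ((2 * g y) ^ (p - 1)) =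
          ENNReal.ofReal (2 ^ (p - 1)) * ENNReal.ofReal (g y) ^ p := by
        intro y
        rw [ENNReal.ofReal_rpow_of_nonneg (hg0 y) hp0.le, ← ENNReal.ofReal_mul (hg0 y),
          ← ENNReal.ofReal_mul (by positivity), Real.mul_rpow zero_le_two (hg0 y)]
        congr 1
        have : g y ^ p = g y * g y ^ (p - 1) := by
          rcases (hg0 y).eq_or_lt with h0 | h0
          · rw [← h0, Real.zero_rpow hp0.ne', zero_mul]
          · rw [Real.rpow_sub_one h0.ne']
            field_simp
        rw [this]
        ring
      simp only [Pi.mul_apply, hpt]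
      rw [lintegral_const_mul' _ _ ENNReal.ofReal_ne_top]
      exact ENNReal.mul_lt_top ENNReal.ofReal_lt_top hgp
    rw [hcake] at hfin
    have hne : ENNReal.ofReal (p - 1) ≠ 0 := by simpa using hp
    refine ENNReal.mul_lt_top ENNReal.ofReal_lt_top (ENNReal.mul_lt_top ?_ ?_)
    · exact ENNReal.mul_lt_top ENNReal.ofNat_lt_top (ENNReal.natCast_lt_top N)
    · exact ENNReal.lt_top_of_mul_ne_top_right hfin.ne hne
  refine lt_of_le_of_lt ?_ hBfin
  rw [lintegral_eq_nnreal]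
  refine iSup₂_le fun φ hφ => ?_
  rw [← SimpleFunc.lintegral_eq_lintegral]
  set u : E → ℝ := fun x => (φ x : ℝ) ^ p⁻¹ with hu
  have hum : Measurable u := φ.measurable.coe_nnreal_real.pow_const _
  have hu0 : ∀ x, 0 ≤ u x := fun x => by positivity
  have hφu : ∀ x, (φ.map ((↑) : NNReal → ℝ≥0∞)) x = ENNReal.ofReal (u x ^ p) := fun x => by
    simp [hu, ← Real.rpow_mul, hp0.ne']
  have huh : ∀ x, ENNReal.ofReal (u x) ≤ h x := fun x => by
    have := hφ x
    rw [← ENNReal.rpow_le_rpow_iff hp0, ENNReal.ofReal_rpow_of_nonneg (hu0 x) hp0.le, ← hφu]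
    simpa using this
  simp only [hφu]
  rw [lintegral_rpow_eq_lintegral_meas_lt_mul P (Eventually.of_forall hu0) hum.aemeasurable hp0,
    hB, ← lintegral_const_mul' (2 * N : ℝ≥0∞) _ (by finiteness)]
  gcongr ENNReal.ofReal p * ?_
  refine setLIntegral_mono' measurableSet_Ioi fun s hs => ?_
  have hs : 0 < s := hs
  have hweak := mul_measure_lt_le_of_forall_exists_ball hτ hN P hg hh hs
  have hsub : P {x | s < u x} ≤ P {x | ENNReal.ofReal s < h x} := measure_mono fun x hx =>
    ((ENNReal.ofReal_lt_ofReal_iff_of_nonneg hs.le).2 hx).trans_le (huh x)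
  have hpow : ENNReal.ofReal (s ^ (p - 1)) =
      2 * ENNReal.ofReal (s / 2) * ENNReal.ofReal (s ^ (p - 1 - 1)) := by
    rw [← ENNReal.ofReal_ofNat 2, ← ENNReal.ofReal_mul (by norm_num),
      ← ENNReal.ofReal_mul (by positivity), Real.rpow_sub_one hs.ne' (p - 1)]
    congr 1
    field_simp
  calc P {x | s < u x} * ENNReal.ofReal (s ^ (p - 1))
      ≤ P {x | ENNReal.ofReal s < h x} * ENNReal.ofReal (s ^ (p - 1)) := by gcongr
    _ = 2 * (ENNReal.ofReal (s / 2) * P {x | ENNReal.ofReal s < h x}) *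
          ENNReal.ofReal (s ^ (p - 1 - 1)) := by rw [hpow]; ring
    _ ≤ 2 * (N * ν {y | s < 2 * g y}) * ENNReal.ofReal (s ^ (p - 1 - 1)) := by gcongr
    _ = 2 * N * (ν {y | s < 2 * g y} * ENNReal.ofReal (s ^ (p - 1 - 1))) := by ring

/-- A convex set with nonempty interior occupies a fixed proportion of every ball of bounded
radius centered at one of its points in a bounded region. -/
theorem exists_forall_addHaar_ball_le_mul_inter {E : Type*} [NormedAddCommGroup E]
    [NormedSpace ℝ E] [FiniteDimensional ℝ E] [MeasurableSpace E] [BorelSpace E]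
    (ν : Measure E) [ν.IsAddHaarMeasure] {C : Set E} (hC : Convex ℝ C)
    (hne : (interior C).Nonempty) (M R : ℝ) :
    ∃ D : ℝ, 0 ≤ D ∧ ∀ x ∈ C, ‖x‖ ≤ M → ∀ t, 0 < t → t ≤ R →
      ν (ball x t) ≤ ENNReal.ofReal D * ν (ball x t ∩ C) := by
  obtain ⟨x₀, hx₀⟩ := hne
  obtain ⟨ρ, hρ, hρC⟩ := Metric.isOpen_iff.1 isOpen_interior x₀ hx₀
  set L := |M| + ‖x₀‖ + ρ + |R| with hL
  have hL0 : 0 < L := by positivity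
  refine ⟨(L / ρ) ^ Module.finrank ℝ E, by positivity, fun x hx hxM t ht htR => ?_⟩
  set s := t / L with hs
  have hs0 : 0 < s := by positivity
  have hsL : s * L = t := by rw [hs]; field_simp
  have hRL : R ≤ L := by
    have := le_abs_self R
    have := abs_nonneg M
    have := norm_nonneg x₀
    linarith
  have hs1 : s ≤ 1 := (div_le_one hL0).2 (htR.trans hRL)
  have hdist : ‖x₀ - x‖ + ρ ≤ L := by
    have := norm_sub_le x₀ x
    have := le_abs_self M
    have := abs_nonneg R
    linarith
  have hsub : ball (x + s • (x₀ - x)) (s * ρ) ⊆ ball x t ∩ C := by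
    intro y hy
    have hys : ‖y - x - s • (x₀ - x)‖ < s * ρ := by
      rwa [mem_ball_iff_norm, ← sub_sub] at hy
    constructor
    · rw [mem_ball_iff_norm]
      have h₁ : ‖y - x‖ ≤ ‖y - x - s • (x₀ - x)‖ + ‖s • (x₀ - x)‖ := by
        simpa using norm_add_le (y - x - s • (x₀ - x)) (s • (x₀ - x))
      rw [norm_smul, Real.norm_of_nonneg hs0.le] at h₁
      nlinarith [mul_le_mul_of_nonneg_left hdist hs0.le]
    · set z := x + s⁻¹ • (y - x) with hz
      have hzC : z ∈ C := by
        refine interior_subset (hρC ?_)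
        have : z - x₀ = s⁻¹ • (y - x - s • (x₀ - x)) := by
          rw [hz, smul_sub s⁻¹ (y - x), smul_smul, inv_mul_cancel₀ hs0.ne', one_smul]
          abel
        rw [mem_ball_iff_norm, this, norm_smul, norm_inv, Real.norm_of_nonneg hs0.le,
          inv_mul_lt_iff₀ hs0]
        exact hys
      have : y = x + s • (z - x) := by
        rw [hz, add_sub_cancel_left, smul_smul, mul_inv_cancel₀ hs0.ne', one_smul,
          add_sub_cancel]
      rw [this]
      exact hC.add_smul_sub_mem hx hzC ⟨hs0.le, hs1⟩
  calc ν (ball x t) = ENNReal.ofReal ((L / ρ) ^ Module.finrank ℝ E) *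
        ν (ball (x + s • (x₀ - x)) (s * ρ)) := by
        rw [Measure.addHaar_ball_of_pos ν _ ht, Measure.addHaar_ball_of_pos ν _ (mul_pos hs0 hρ),
          ← mul_assoc, ← ENNReal.ofReal_mul (by positivity), ← mul_pow]
        congr 3
        rw [← hsL]
        field_simp
    _ ≤ _ := by gcongr

/-- A finite union of closed convex sets: outside a null set, balls of bounded radius centered in a
bounded part of the union meet it in a fixed proportion of their volume. -/
theorem exists_ae_forall_addHaar_ball_le_mul_inter {E : Type*} [NormedAddCommGroup E]
    [NormedSpace ℝ E] [FiniteDimensional ℝ E] [MeasurableSpace E] [BorelSpace E]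
    (ν : Measure E) [ν.IsAddHaarMeasure] {ι : Type*} [Fintype ι] {C : ι → Set E}
    (hcl : ∀ i, IsClosed (C i)) (hC : ∀ i, Convex ℝ (C i)) (M R : ℝ) :
    ∃ D : ℝ, 0 ≤ D ∧ ∀ᵐ x ∂ν, x ∈ ⋃ i, C i → ‖x‖ ≤ M → ∀ t, 0 < t → t ≤ R →
      ν (ball x t) ≤ ENNReal.ofReal D * ν (ball x t ∩ ⋃ i, C i) := by
  have key : ∀ i, ∃ D : ℝ, 0 ≤ D ∧ ∀ᵐ x ∂ν, x ∈ C i → ‖x‖ ≤ M → ∀ t, 0 < t → t ≤ R →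
      ν (ball x t) ≤ ENNReal.ofReal D * ν (ball x t ∩ C i) := by
    intro i
    rcases (interior (C i)).eq_empty_or_nonempty with h | h
    · refine ⟨0, le_rfl, ?_⟩
      have hnull : ν (C i) = 0 := by
        rw [← (hC i).addHaar_frontier ν, (hcl i).frontier_eq, h, sdiff_empty]
      filter_upwards [measure_eq_zero_iff_ae_notMem.1 hnull] with x hx hxC
      exact absurd hxC hx
    · obtain ⟨D, hD0, hD⟩ := exists_forall_addHaar_ball_le_mul_inter ν (hC i) h M R
      exact ⟨D, hD0, Eventually.of_forall hD⟩
  choose D hD0 hD using key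
  refine ⟨∑ i, D i, Finset.sum_nonneg fun i _ => hD0 i, ?_⟩
  filter_upwards [ae_all_iff.2 hD] with x hx hxC hxM t ht htR
  obtain ⟨i, hi⟩ := mem_iUnion.1 hxC
  refine (hx i hi hxM t ht htR).trans ?_
  gcongr
  · exact Finset.single_le_sum (fun j _ => hD0 j) (Finset.mem_univ i)
  · exact subset_iUnion C i

/-- Codebooks with vanishing quantization error stay at bounded distance from bounded sets. -/
theorem exists_forall_qdist_le {d : ℕ} (P : Measure (EuclideanSpace ℝ (Fin d)))
    [IsProbabilityMeasure P] {r : ℝ} (hr : 0 < r)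
    (α : ℕ → Finset (EuclideanSpace ℝ (Fin d)))
    (hconv : Tendsto (fun n : ℕ => qerr P r (α n)) atTop (𝓝 0)) (M : ℝ) :
    ∃ R : ℝ, ∀ n x, ‖x‖ ≤ M → qdist x (α n) ≤ R := by
  obtain ⟨m, hm⟩ : ∃ m : ℕ, 0 < P (ball 0 (m : ℝ)) := by
    by_contra! hcon
    have : P (⋃ m : ℕ, ball 0 (m : ℝ)) = 0 :=
      measure_iUnion_null fun m => nonpos_iff_eq_zero.1 (hcon m)
    rw [iUnion_ball_nat, measure_univ] at this
    exact one_ne_zero this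
  have hlip : ∀ n (x y : EuclideanSpace ℝ (Fin d)),
      qdist x (α n) ≤ qdist y (α n) + dist x y := fun n x y => infDist_le_infDist_add_dist
  have hev : ∀ᶠ n in atTop, qdist 0 (α n) ≤ m + 1 := by
    filter_upwards [hconv.eventually (gt_mem_nhds hm)] with n hn
    by_contra! hlt
    refine hn.not_ge ?_
    calc P (ball 0 (m : ℝ)) = ∫⁻ _ in ball 0 (m : ℝ), 1 ∂P := (setLIntegral_one _).symm
      _ ≤ ∫⁻ x in ball 0 (m : ℝ), ENNReal.ofReal (qdist x (α n)) ^ r ∂P := by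
          refine setLIntegral_mono' measurableSet_ball fun x hx => ENNReal.one_le_rpow ?_ hr
          have := hlip n 0 x
          rw [mem_ball'] at hx
          rw [ENNReal.one_le_ofReal]
          linarith
      _ ≤ qerr P r (α n) := setLIntegral_le_lintegral _ _
  have hbdd : IsBoundedUnder (· ≤ ·) cofinite fun n => qdist 0 (α n) := by
    rw [Nat.cofinite_eq_atTop]
    exact ⟨m + 1, eventually_map.2 hev⟩
  obtain ⟨R, hR⟩ := hbdd.bddAbove_range_of_cofinite
  refine ⟨R + M, fun n x hx => ?_⟩
  have h₁ := hlip n x 0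
  have h₂ : qdist 0 (α n) ≤ R := hR ⟨n, rfl⟩
  rw [dist_zero_right] at h₁
  linarith

/-- A measure gives no mass to the complement of its support. -/
theorem ae_mem_msupp {d : ℕ} (P : Measure (EuclideanSpace ℝ (Fin d))) :
    ∀ᵐ x ∂P, x ∈ msupp P := by
  refine measure_null_of_locally_null _ fun x hx => ?_
  simp only [msupp, mem_compl_iff, mem_ofPred_eq, not_forall, not_lt, nonpos_iff_eq_zero] at hx
  obtain ⟨ε, hε, h0⟩ := hx
  exact ⟨ball x ε, mem_nhdsWithin_of_mem_nhds (ball_mem_nhds x hε), h0⟩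

/-- The image of Lebesgue measure under the dilation defining `Pdil` is a multiple of it. -/
theorem map_dilation_volume {d : ℕ} {θ : ℝ} (hθ : 0 < θ) (μ : EuclideanSpace ℝ (Fin d)) :
    Measure.map (fun x => μ + θ⁻¹ • (x - μ)) (volume : Measure (EuclideanSpace ℝ (Fin d))) =
      ENNReal.ofReal (θ ^ d) • volume := by
  have hcomp : (fun x : EuclideanSpace ℝ (Fin d) => μ + θ⁻¹ • (x - μ)) =
      (fun x => μ + x) ∘ (fun x => θ⁻¹ • x) ∘ fun x => x - μ := rfl
  rw [hcomp, ← Measure.map_map (by fun_prop) (by fun_prop),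
    ← Measure.map_map (by fun_prop) (by fun_prop), (measurePreserving_sub_right _ μ).map_eq,
    Measure.map_addHaar_smul _ (inv_ne_zero hθ.ne'), Measure.map_smul, map_add_left_eq_self]
  congr 2
  simp [abs_of_pos hθ]

/-- The dilated measure has density `θ ^ d * f_{θ,μ}`. -/
theorem Pdil_withDensity {d : ℕ} {f : EuclideanSpace ℝ (Fin d) → ℝ} (hfm : Measurable f)
    {θ : ℝ} (hθ : 0 < θ) (μ : EuclideanSpace ℝ (Fin d)) :
    Pdil (volume.withDensity fun x => ENNReal.ofReal (f x)) θ μ =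
      ENNReal.ofReal (θ ^ d) • volume.withDensity fun x => ENNReal.ofReal (fdil f θ μ x) := by
  have hT : Measurable fun x : EuclideanSpace ℝ (Fin d) => μ + θ⁻¹ • (x - μ) := by fun_prop
  have hinv : ∀ x, fdil f θ μ (μ + θ⁻¹ • (x - μ)) = f x := fun x => by
    simp [fdil, smul_smul, hθ.ne']
  have hfd : Measurable fun x => ENNReal.ofReal (fdil f θ μ x) := by
    have : Measurable fun x : EuclideanSpace ℝ (Fin d) => μ + θ • (x - μ) := by fun_prop
    exact (hfm.comp this).ennreal_ofReal
  ext s hs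
  rw [Pdil, Measure.map_apply hT hs, withDensity_apply _ (hT hs), Measure.smul_apply,
    withDensity_apply _ hs, ← lintegral_smul_measure, ← Measure.restrict_smul,
    ← map_dilation_volume hθ μ, setLIntegral_map hs hfd hT]
  simp only [hinv]

/-- Under admissibility and (H1), the dilated measure is dominated on bounded sets by a multiple
of the original one. -/
theorem exists_restrict_Pdil_le {d : ℕ} {f : EuclideanSpace ℝ (Fin d) → ℝ}
    (hf0 : ∀ x, 0 ≤ f x) (hfm : Measurable f) {θ : ℝ} (hθ : 0 < θ)
    {μ : EuclideanSpace ℝ (Fin d)} (hadm : Admissible f θ μ) (h1 : H1 f θ μ)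
    {K : Set (EuclideanSpace ℝ (Fin d))} (hK : IsCompact K) :
    ∃ c : ℝ≥0∞, c ≠ ⊤ ∧ (Pdil (volume.withDensity fun x => ENNReal.ofReal (f x)) θ μ).restrict K ≤
      c • (volume.withDensity fun x => ENNReal.ofReal (f x)).restrict K := by
  have hT : Measurable fun x : EuclideanSpace ℝ (Fin d) => μ + θ⁻¹ • (x - μ) := by fun_prop
  have hS : Measurable fun x : EuclideanSpace ℝ (Fin d) => μ + θ • (x - μ) := by fun_prop
  obtain ⟨M, hM0, hM⟩ := hK.isBounded.subset_ball_lt 0 0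
  obtain ⟨C, hC⟩ := h1 M hM0
  have hadm' : ∀ᵐ x ∂(volume : Measure (EuclideanSpace ℝ (Fin d))),
      0 < f (μ + θ • (x - μ)) → 0 < f x := by
    have hmeas : MeasurableSet {x | 0 < f (μ + θ • (x - μ)) → 0 < f x} :=
      (measurableSet_lt measurable_const (hfm.comp hS)).imp (measurableSet_lt measurable_const hfm)
    have h : ∀ᵐ x ∂(ENNReal.ofReal (θ ^ d) • (volume : Measure (EuclideanSpace ℝ (Fin d)))),
        0 < f (μ + θ • (x - μ)) → 0 < f x := by
      rw [← map_dilation_volume hθ μ, ae_map_iff hT.aemeasurable hmeas]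
      filter_upwards [hadm] with x hx
      simpa [smul_smul, hθ.ne'] using hx
    rwa [Measure.ae_ennreal_smul_measure_iff (by simpa using pow_pos hθ d)] at h
  refine ⟨ENNReal.ofReal (θ ^ d) * ENNReal.ofReal C, by finiteness, ?_⟩
  rw [Pdil_withDensity hfm hθ, Measure.restrict_smul, mul_smul,
    restrict_withDensity hK.measurableSet, restrict_withDensity hK.measurableSet,
    ← withDensity_smul _ hfm.ennreal_ofReal]
  gcongr
  refine withDensity_mono ?_
  filter_upwards [ae_restrict_of_ae hadm', ae_restrict_mem hK.measurableSet] with x hx hxK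
  simp only [Pi.smul_apply, smul_eq_mul, fdil]
  rcases (hf0 x).eq_or_lt with h0 | h0
  · have : f (μ + θ • (x - μ)) ≤ 0 := not_lt.1 fun h => (hx h).ne h0
    simp [ENNReal.ofReal_of_nonpos this]
  · rw [← ENNReal.ofReal_mul' h0.le]
    exact ENNReal.ofReal_le_ofReal ((div_le_iff₀ h0).1 (hC x (hM hxK) h0))

/-- Under (H3), the reciprocal of the density integrates over a ball to at least the volume of the
part of the ball lying in the support. -/
theorem volume_inter_msupp_le_lintegral_inv {d : ℕ} {f : EuclideanSpace ℝ (Fin d) → ℝ}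
    (hfm : Measurable f) {P : Measure (EuclideanSpace ℝ (Fin d))}
    (hP : P = volume.withDensity fun x => ENNReal.ofReal (f x))
    (hac : volume.restrict (msupp P) ≪ P) {B : Set (EuclideanSpace ℝ (Fin d))}
    (hB : MeasurableSet B) :
    volume (B ∩ msupp P) ≤ ∫⁻ y in B, ENNReal.ofReal (f y)⁻¹ ∂P := by
  have hpos : MeasurableSet {y | 0 < f y} := measurableSet_lt measurable_const hfm
  have hPpos : P {y | 0 < f y}ᶜ = 0 := by
    rw [hP, withDensity_apply _ hpos.compl]
    refine (setLIntegral_congr_fun hpos.compl fun y hy => ?_).trans lintegral_zero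
    simpa using hy
  have hnull : volume ({y | 0 < f y}ᶜ ∩ msupp P) = 0 := by
    rw [← Measure.restrict_apply hpos.compl]
    exact hac hPpos
  calc volume (B ∩ msupp P) ≤ volume (B ∩ {y | 0 < f y}) := by
        refine (measure_mono (t := (B ∩ {y | 0 < f y}) ∪ ({y | 0 < f y}ᶜ ∩ msupp P))
          fun y hy => ?_).trans ((measure_union_le _ _).trans (by rw [hnull, add_zero]))
        by_cases h : 0 < f y
        · exact Or.inl ⟨hy.1, h⟩
        · exact Or.inr ⟨h, hy.2⟩
    _ = ∫⁻ _ in B ∩ {y | 0 < f y}, 1 := (setLIntegral_one _).symm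
    _ = ∫⁻ y in B ∩ {y | 0 < f y}, ENNReal.ofReal (f y) * ENNReal.ofReal (f y)⁻¹ := by
        refine setLIntegral_congr_fun (hB.inter hpos) fun y hy => ?_
        have hy : 0 < f y := hy.2
        rw [← ENNReal.ofReal_mul hy.le, mul_inv_cancel₀ hy.ne', ENNReal.ofReal_one]
    _ ≤ ∫⁻ y in B, ENNReal.ofReal (f y) * ENNReal.ofReal (f y)⁻¹ :=
        lintegral_mono_set inter_subset_left
    _ = ∫⁻ y in B, ENNReal.ofReal (f y)⁻¹ ∂P := by
        rw [hP, setLIntegral_withDensity_eq_setLIntegral_mul _ hfm.ennreal_ofReal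
          (g := fun y => ENNReal.ofReal (f y)⁻¹) hfm.inv.ennreal_ofReal hB]
        rfl

/-- **Lemma 3.2 (b).**
Let `P = f·λ_d` with `∫ |x|^r dP < ∞`, let `(α_n)` be finite codebooks with
`∫ d(x,α_n)^r dP → 0`, and let `(θ,μ)` be `P`-admissible satisfying (H1) and (H3).
Then for every `p ∈ (1,∞)` and every `b > 0`: if `f^{-p}` is locally
`P`-integrable, then `ψ_b^p` is locally `P_{θ,μ}`-integrable. -/
theorem stmt_4 {d : ℕ} (hd : 1 ≤ d)
    (f : EuclideanSpace ℝ (Fin d) → ℝ) (hf0 : ∀ x, 0 ≤ f x) (hfm : Measurable f)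
    (P : Measure (EuclideanSpace ℝ (Fin d))) [IsProbabilityMeasure P]
    (hP : P = volume.withDensity fun x => ENNReal.ofReal (f x))
    (r : ℝ) (hr : 0 < r)
    (hmom : (∫⁻ x, ENNReal.ofReal ‖x‖ ^ r ∂P) ≠ ⊤)
    (α : ℕ → Finset (EuclideanSpace ℝ (Fin d)))
    (hne : ∀ n, 1 ≤ n → (α n).Nonempty)
    (hconv : Tendsto (fun n : ℕ => qerr P r (α n)) atTop (𝓝 0))
    (θ : ℝ) (hθ : 0 < θ) (μ : EuclideanSpace ℝ (Fin d))
    (hadm : Admissible f θ μ) (h1 : H1 f θ μ) (h3 : H3 P)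
    (p : ℝ) (hp : 1 < p) (b : ℝ) (hb : 0 < b)
    (hloc : ∀ K : Set (EuclideanSpace ℝ (Fin d)), IsCompact K →
      (∫⁻ x in K, ENNReal.ofReal (f x) ^ (-p) ∂P) < ⊤) :
    ∀ K : Set (EuclideanSpace ℝ (Fin d)), IsCompact K →
      (∫⁻ x in K, maxFun P α b x ^ p ∂(Pdil P θ μ)) < ⊤ := by
  intro K hK
  suffices hPK : ∫⁻ x in K, maxFun P α b x ^ p ∂P < ⊤ by
    obtain ⟨c, hc, hle⟩ := exists_restrict_Pdil_le hf0 hfm hθ hadm h1 hK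
    rw [← hP] at hle
    refine (lintegral_mono' hle le_rfl).trans_lt ?_
    rw [lintegral_smul_measure]
    exact ENNReal.mul_lt_top hc.lt_top hPK
  have hp0 : 0 < p := zero_lt_one.trans hp
  obtain ⟨hac, k, C, hC, hsupp⟩ := h3
  obtain ⟨M, hM⟩ := hK.isBounded.exists_norm_le
  obtain ⟨R, hR⟩ := exists_forall_qdist_le P hr α hconv M
  obtain ⟨D, hD0, hD⟩ := exists_ae_forall_addHaar_ball_le_mul_inter
    (volume : Measure (EuclideanSpace ℝ (Fin d))) (fun i => (hC i).1) (fun i => (hC i).2) M (b * R)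
  rw [← hsupp] at hD
  set G := {x | x ∈ K ∧ ∀ t, 0 < t → t ≤ b * R →
    volume (ball x t) ≤ ENNReal.ofReal D * volume (ball x t ∩ msupp P)} with hG
  set K' := closedBall (0 : EuclideanSpace ℝ (Fin d)) (M + b * R) with hK'
  set g : EuclideanSpace ℝ (Fin d) → ℝ := fun y => D * K'.indicator (fun y => (f y)⁻¹) y with hg
  have hgm : Measurable g := (hfm.inv.indicator measurableSet_closedBall).const_mul D
  have hg0 : ∀ y, 0 ≤ g y := fun y =>
    mul_nonneg hD0 (indicator_nonneg (fun y _ => inv_nonneg.2 (hf0 y)) y)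
  have hgp : ∫⁻ x, ENNReal.ofReal (g x) ^ p ∂P < ⊤ := by
    have hpt : ∀ x, ENNReal.ofReal (g x) ^ p ≤ ENNReal.ofReal D ^ p *
        K'.indicator (fun y => ENNReal.ofReal (f y) ^ (-p)) x := by
      intro x
      by_cases hx : x ∈ K'
      · simp only [hg, indicator_of_mem hx]
        rw [ENNReal.ofReal_mul hD0, ENNReal.mul_rpow_of_nonneg _ _ hp0.le, ENNReal.rpow_neg,
          ← ENNReal.inv_rpow]
        gcongr
        exact ENNReal.ofReal_inv_le
      · simp [hg, hx, hp0]
    refine (lintegral_mono hpt).trans_lt ?_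
    rw [lintegral_const_mul' _ _ (by finiteness), lintegral_indicator measurableSet_closedBall]
    exact ENNReal.mul_lt_top (by finiteness) (hloc K' (isCompact_closedBall _ _))
  have hstrong := lintegral_rpow_lt_top_of_forall_exists_ball P hgm hg0 (R := b * R)
    (h := G.indicator (maxFun P α b)) (fun x s hs => ?_) hp hgp
  · refine lt_of_le_of_lt ?_ hstrong
    refine (lintegral_mono_ae ?_).trans (lintegral_mono' Measure.restrict_le_self le_rfl)
    have hPac : P ≪ volume := hP ▸ withDensity_absolutelyContinuous _ _
    filter_upwards [ae_restrict_mem hK.measurableSet, ae_restrict_of_ae (hPac.ae_le hD),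
      ae_restrict_of_ae (ae_mem_msupp P)] with x hxK hxD hxs
    have hxG : x ∈ G := ⟨hxK, hxD hxs (hM x hxK)⟩
    rw [indicator_of_mem hxG]
  · have hxG : x ∈ G := by
      by_contra hx
      simp [indicator_of_notMem hx] at hs
    rw [indicator_of_mem hxG, maxFun, lt_iSup_iff] at hs
    obtain ⟨n, hs⟩ := hs
    obtain ⟨-, hs⟩ := lt_iSup_iff.1 hs
    have hs := ENNReal.mul_lt_of_lt_div hs
    set t := b * qdist x (α n) with ht
    have ht0 : 0 < t := by
      by_contra! ht0
      simp [ball_eq_empty.2 ht0] at hs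
    have htR : t ≤ b * R := mul_le_mul_of_nonneg_left (hR n x (hM x hxG.1)) hb.le
    refine ⟨t, ht0, htR, hs.trans_le ?_⟩
    have hsub : ball x t ⊆ K' := by
      refine ball_subset_closedBall.trans (closedBall_subset_closedBall' ?_)
      have := hM x hxG.1
      rw [dist_zero_right]
      linarith
    calc volume (ball x t) ≤ ENNReal.ofReal D * volume (ball x t ∩ msupp P) :=
          hxG.2 t ht0 htR
      _ ≤ ENNReal.ofReal D * ∫⁻ y in ball x t, ENNReal.ofReal (f y)⁻¹ ∂P := by
          gcongr
          exact volume_inter_msupp_le_lintegral_inv hfm hP hac measurableSet_ball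
      _ = ∫⁻ y in ball x t, ENNReal.ofReal D * ENNReal.ofReal (f y)⁻¹ ∂P :=
          (lintegral_const_mul' _ _ ENNReal.ofReal_ne_top).symm
      _ = ∫⁻ y in ball x t, ENNReal.ofReal (g y) ∂P := by
          refine setLIntegral_congr_fun measurableSet_ball fun y hy => ?_
          simp only [hg, indicator_of_mem (hsub hy)]
          rw [ENNReal.ofReal_mul hD0]
end
end

section
/- Let r > 0 and s ∈ (r+d, ∞), and let X be an ℝ^d-valued random variable with distribution P = f·λ_d such that E|X|^{r+η} < ∞ for some η > 0. Let (α_n)_{n≥1} be an L^r(P)-optimal sequence of quantizers, and let θ > 0, μ ∈ ℝ^d be such that (θ,μ) is P-admissible and hypotheses (H1), (H2) and (H3) hold. If moreover f^{−s/(r+d)} is locally P-integrable, then there exists b ∈ (0,1/2) such that ∫_{ℝ^d} ψ_b^{s/(d+r)} dP_{θ,μ} < ∞. -/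
open MeasureTheory ENNReal Filter Set Metric Topology
open scoped Classical

noncomputable section

/-- Weak-type bound from the Besicovitch covering theorem, for an arbitrary measure `P`. -/
theorem exists_measure_ball_le_mul {E : Type*} [MetricSpace E]
    [SecondCountableTopology E] [MeasurableSpace E] [BorelSpace E] [HasBesicovitchCovering E] :
    ∃ N : ℕ, ∀ (P ν : Measure E) (T : ℝ) (c : ℝ≥0∞),
      P {x | ∃ t ∈ Ioc (0 : ℝ) T, P (ball x t) ≤ c * ν (ball x t)} ≤ N * (c * ν univ) := by
  obtain ⟨N, τ, hτ, hN⟩ := HasBesicovitchCovering.no_satelliteConfig (α := E)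
  refine ⟨N, fun P ν T c => ?_⟩
  set A := {x | ∃ t ∈ Ioc (0 : ℝ) T, P (ball x t) ≤ c * ν (ball x t)} with hA
  choose! ρ hρ hρle using fun x (hx : x ∈ A) => hx
  let q : Besicovitch.BallPackage A E :=
    { c := fun x => x
      r := fun x => ρ x
      rpos := fun x => (hρ x x.2).1
      r_bound := T
      r_le := fun x => (hρ x x.2).2 }
  obtain ⟨u, hu, hcov⟩ := Besicovitch.exist_disjoint_covering_families hτ hN q
  have hd : ∀ i, (u i).PairwiseDisjoint fun j => ball (q.c j) (q.r j) := fun i =>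
    (hu i).mono fun j => ball_subset_closedBall
  have hc : ∀ i, (u i).Countable := fun i =>
    (hd i).countable_of_isOpen (fun _ _ => isOpen_ball)
      fun j _ => nonempty_ball.2 (q.rpos j)
  have hone : ∀ i, P (⋃ j ∈ u i, ball (q.c j) (q.r j)) ≤ c * ν univ := by
    intro i
    calc P (⋃ j ∈ u i, ball (q.c j) (q.r j))
        ≤ ∑' j : u i, P (ball (q.c j) (q.r j)) := measure_biUnion_le P (hc i) _
      _ ≤ ∑' j : u i, c * ν (ball (q.c j) (q.r j)) :=
          ENNReal.tsum_le_tsum fun j => hρle _ j.1.2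
      _ = c * ∑' j : u i, ν (ball (q.c j) (q.r j)) := ENNReal.tsum_mul_left
      _ ≤ c * ν univ := by
          gcongr
          refine tsum_measure_le_measure_univ
            (fun j => isOpen_ball.measurableSet.nullMeasurableSet) ?_
          intro j k hjk
          exact ((hd i).subtype _ _ hjk).aedisjoint
  calc P A ≤ P (⋃ i : Fin N, ⋃ j ∈ u i, ball (q.c j) (q.r j)) := by
        refine measure_mono fun x hx => hcov ⟨⟨x, hx⟩, rfl⟩
    _ ≤ ∑ i : Fin N, P (⋃ j ∈ u i, ball (q.c j) (q.r j)) := measure_iUnion_fintype_le _ _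
    _ ≤ ∑ _i : Fin N, c * ν univ := Finset.sum_le_sum fun i _ => hone i
    _ = N * (c * ν univ) := by simp

theorem ENNReal.exists_two_pow_lt_le {a : ℝ≥0∞} (ha : 1 < a) (ha' : a ≠ ⊤) :
    ∃ k : ℕ, 2 ^ k < a ∧ a ≤ 2 ^ (k + 1) := by
  have hex : ∃ m : ℕ, a ≤ 2 ^ m := by
    obtain ⟨m, hm⟩ := ENNReal.exists_nat_gt ha'
    refine ⟨m, hm.le.trans ?_⟩
    exact_mod_cast (Nat.lt_two_pow_self).le
  have h0 : Nat.find hex ≠ 0 := by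
    intro h
    have := Nat.find_spec hex
    rw [h, pow_zero] at this
    exact absurd this (not_le.2 ha)
  obtain ⟨k, hk⟩ := Nat.exists_eq_succ_of_ne_zero h0
  refine ⟨k, not_le.1 (Nat.find_min hex (by omega)), ?_⟩
  have := Nat.find_spec hex
  rwa [hk] at this

/-- Dyadic layer-cake bound; no measurability of `F` is required. -/
theorem lintegral_rpow_le_tsum_two_pow {Ω : Type*} [MeasurableSpace Ω] (P : Measure Ω)
    (F : Ω → ℝ≥0∞) {q : ℝ} (hq : 0 < q) :
    ∫⁻ x, F x ^ q ∂P ≤ P univ + ∑' k : ℕ, (2 ^ (k + 1)) ^ q * P {x | 2 ^ k < F x} := by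
  let S : ℕ → Set Ω := fun k => toMeasurable P {x | 2 ^ k < F x}
  have hS : ∀ k, MeasurableSet (S k) := fun k => measurableSet_toMeasurable _ _
  have hmem : ∀ k x, 2 ^ k < F x → x ∈ S k := fun k x hx => subset_toMeasurable _ _ hx
  have hpt : ∀ x, F x ^ q ≤
      1 + ∑' k : ℕ, (S k).indicator (fun _ => ((2 : ℝ≥0∞) ^ (k + 1)) ^ q) x := by
    intro x
    rcases le_or_gt (F x) 1 with h | h
    · exact (ENNReal.rpow_le_one h hq.le).trans le_self_add
    by_cases ht : F x = ⊤
    · have : ∑' k : ℕ, (S k).indicator (fun _ => ((2 : ℝ≥0∞) ^ (k + 1)) ^ q) x = ⊤ := by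
        rw [eq_top_iff, ← ENNReal.tsum_const_eq_top_of_ne_zero (α := ℕ) one_ne_zero]
        refine ENNReal.tsum_le_tsum fun k => ?_
        rw [indicator_of_mem (hmem k x (by rw [ht]; exact ENNReal.pow_lt_top (by simp)))]
        exact ENNReal.one_le_rpow (one_le_pow₀ (by norm_num)) hq
      rw [this]; simp
    obtain ⟨k, hk, hk'⟩ := ENNReal.exists_two_pow_lt_le h ht
    calc F x ^ q ≤ (2 ^ (k + 1)) ^ q := ENNReal.rpow_le_rpow hk' hq.le
      _ = (S k).indicator (fun _ => ((2 : ℝ≥0∞) ^ (k + 1)) ^ q) x := by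
          rw [indicator_of_mem (hmem k x hk)]
      _ ≤ ∑' k : ℕ, (S k).indicator (fun _ => ((2 : ℝ≥0∞) ^ (k + 1)) ^ q) x :=
          ENNReal.le_tsum k
      _ ≤ _ := le_add_self
  calc ∫⁻ x, F x ^ q ∂P
      ≤ ∫⁻ x, 1 + ∑' k : ℕ, (S k).indicator (fun _ => ((2 : ℝ≥0∞) ^ (k + 1)) ^ q) x ∂P :=
        lintegral_mono hpt
    _ = P univ + ∑' k : ℕ, (2 ^ (k + 1)) ^ q * P {x | 2 ^ k < F x} := by
        rw [lintegral_add_left measurable_const,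
          lintegral_tsum fun k => (measurable_const.indicator (hS k)).aemeasurable]
        simp only [lintegral_indicator_const (hS _), lintegral_const, one_mul, S,
          measure_toMeasurable]

theorem ENNReal.exists_tsum_two_pow_indicator_le {p : ℝ} (hp : 0 < p) :
    ∃ D : ℝ≥0∞, D ≠ ⊤ ∧ ∀ a : ℝ≥0∞,
      ∑' k : ℕ, (if 2 ^ k < a then ((2 : ℝ≥0∞) ^ k) ^ p else 0) ≤ D * a ^ p := by
  set y : ℝ≥0∞ := (2 : ℝ≥0∞)⁻¹ ^ p with hy
  have hy1 : y < 1 := ENNReal.rpow_lt_one (by norm_num) hp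
  have hD : (∑' j : ℕ, y ^ j) ≠ ⊤ := by
    rw [ENNReal.tsum_geometric]
    exact ENNReal.inv_ne_top.2 (tsub_pos_of_lt hy1).ne'
  have hD1 : 1 ≤ ∑' j : ℕ, y ^ j := by
    simp
  refine ⟨∑' j : ℕ, y ^ j, hD, fun a => ?_⟩
  rcases le_or_gt a 1 with h | h
  · have : ∀ k : ℕ, ¬ (2 : ℝ≥0∞) ^ k < a := fun k hk =>
      absurd (h.trans (one_le_pow₀ (by norm_num))) (not_le.2 hk)
    simp [this]
  by_cases ht : a = ⊤
  · rw [ht, ENNReal.top_rpow_of_pos hp, ENNReal.mul_top (by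
      exact (zero_lt_one.trans_le hD1).ne')]
    exact le_top
  obtain ⟨m, hm, hm'⟩ := ENNReal.exists_two_pow_lt_le h ht
  have hz : ∀ k ∉ Finset.range (m + 1),
      (if 2 ^ k < a then ((2 : ℝ≥0∞) ^ k) ^ p else 0) = 0 := by
    intro k hk
    rw [Finset.mem_range, not_lt] at hk
    exact if_neg (not_lt.2 (hm'.trans (pow_le_pow_right₀ (by norm_num) hk)))
  rw [tsum_eq_sum hz, ← Finset.sum_range_reflect]
  calc ∑ j ∈ Finset.range (m + 1), (if (2 : ℝ≥0∞) ^ (m + 1 - 1 - j) < a then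
          ((2 : ℝ≥0∞) ^ (m + 1 - 1 - j)) ^ p else 0)
      ≤ ∑ j ∈ Finset.range (m + 1), y ^ j * a ^ p := by
        refine Finset.sum_le_sum fun j hj => ?_
        have hjm : j ≤ m := by simpa [Nat.lt_succ_iff] using hj
        split_ifs
        · calc ((2 : ℝ≥0∞) ^ (m + 1 - 1 - j)) ^ p ≤ ((2 : ℝ≥0∞)⁻¹ ^ j * a) ^ p := by
                refine ENNReal.rpow_le_rpow ?_ hp.le
                calc (2 : ℝ≥0∞) ^ (m + 1 - 1 - j)
                    = (2 : ℝ≥0∞)⁻¹ ^ j * 2 ^ m := by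
                      have h2 : (2 : ℝ≥0∞) ^ m = 2 ^ j * 2 ^ (m - j) := by
                        rw [← pow_add]; congr 1; omega
                      rw [h2, ← mul_assoc, ← mul_pow,
                        ENNReal.inv_mul_cancel (by norm_num) (by norm_num), one_pow, one_mul]
                      congr 1
                  _ ≤ _ := by gcongr
            _ = y ^ j * a ^ p := by
                rw [ENNReal.mul_rpow_of_nonneg _ _ hp.le, hy, ← ENNReal.rpow_natCast,
                  ← ENNReal.rpow_natCast, ← ENNReal.rpow_mul, ← ENNReal.rpow_mul, mul_comm p]
        · exact zero_le
    _ = (∑ j ∈ Finset.range (m + 1), y ^ j) * a ^ p := (Finset.sum_mul _ _ _).symm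
    _ ≤ _ := by gcongr; exact ENNReal.sum_le_tsum _

theorem two_mul_measure_le_of_two_le_mul {Ω : Type*} [MeasurableSpace Ω] (m : Measure Ω)
    {φ : Ω → ℝ≥0∞} (hφ : Measurable φ) {S : Set Ω} (hS : MeasurableSet S) {a : ℝ≥0∞}
    (h : ∀ x ∈ S, 2 ≤ a * φ x) : 2 * m S ≤ a * m.withDensity φ S := by
  rw [withDensity_apply _ hS, ← lintegral_const_mul _ hφ, ← setLIntegral_const]
  exact setLIntegral_mono (hφ.const_mul _) h

/-- Local `L^q`-bound for the centred maximal function of `m.restrict A` with respect to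
`P = φ • m`. -/
theorem lintegral_maximal_rpow_lt_top {E : Type*} [MetricSpace E]
    [SecondCountableTopology E] [MeasurableSpace E] [BorelSpace E] [HasBesicovitchCovering E]
    (m P : Measure E) [IsFiniteMeasure P] {φ : E → ℝ≥0∞} (hφ : Measurable φ)
    (hφt : ∀ x, φ x ≠ ⊤) (hP : P = m.withDensity φ) {A : Set E} (hA : MeasurableSet A)
    (hA0 : ∀ x ∈ A, φ x ≠ 0) {q : ℝ} (hq : 1 < q)
    (hint : ∫⁻ x in A, φ x ^ (-q) ∂P < ⊤) (T : ℝ) :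
    ∫⁻ x, (⨆ t ∈ Ioc (0 : ℝ) T, m (A ∩ ball x t) / P (ball x t)) ^ q ∂P < ⊤ := by
  obtain ⟨N, hN⟩ := exists_measure_ball_le_mul (E := E)
  obtain ⟨D, hD, hDle⟩ := ENNReal.exists_tsum_two_pow_indicator_le (sub_pos.2 hq)
  have hq0 : 0 < q := zero_lt_one.trans hq
  let L : ℕ → Set E := fun k => A ∩ {x | 2 ^ k < 2 / φ x}
  have hmk : ∀ k : ℕ, MeasurableSet {x | 2 ^ k < 2 / φ x} := fun k =>
    measurableSet_lt measurable_const (measurable_const.div hφ)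
  have h2k0 : ∀ k : ℕ, (2 : ℝ≥0∞) ^ k ≠ 0 := fun k => by simp
  have h2kt : ∀ k : ℕ, (2 : ℝ≥0∞) ^ k ≠ ⊤ := fun k => ENNReal.pow_ne_top (by simp)
  have hweak : ∀ k : ℕ,
      P {x | 2 ^ k < ⨆ t ∈ Ioc (0 : ℝ) T, m (A ∩ ball x t) / P (ball x t)}
        ≤ N * (2 / 2 ^ k * m (L k)) := by
    intro k
    have := hN P (m.restrict (L k)) T (2 / 2 ^ k)
    rw [Measure.restrict_apply_univ] at this
    refine (measure_mono ?_).trans this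
    intro x hx
    simp only [mem_ofPred_eq, lt_iSup_iff] at hx
    obtain ⟨t, ht, hlt⟩ := hx
    refine ⟨t, ht, ?_⟩
    have hPt : P (ball x t) ≠ ⊤ := measure_ne_top _ _
    have h1 : 2 ^ k * P (ball x t) < m (A ∩ ball x t) := by
      by_cases hP0 : P (ball x t) = 0
      · rw [hP0, mul_zero]
        refine pos_iff_ne_zero.2 fun h0 => ?_
        rw [h0, ENNReal.zero_div] at hlt
        exact not_lt_bot hlt
      · exact (ENNReal.lt_div_iff_mul_lt (Or.inl hP0) (Or.inl hPt)).1 hlt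
    have h2 : 2 * m ((A \ {x | 2 ^ k < 2 / φ x}) ∩ ball x t) ≤ 2 ^ k * P (ball x t) := by
      calc _ ≤ 2 ^ k * P ((A \ {x | 2 ^ k < 2 / φ x}) ∩ ball x t) := by
            rw [hP]
            refine two_mul_measure_le_of_two_le_mul m hφ
              ((hA.diff (hmk k)).inter isOpen_ball.measurableSet) ?_
            rintro y ⟨⟨hyA, hy⟩, -⟩
            simp only [mem_ofPred_eq, not_lt] at hy
            exact (ENNReal.div_le_iff (hA0 y hyA) (hφt y)).1 hy
        _ ≤ _ := by gcongr; exact inter_subset_right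
    have h3 : m (A ∩ ball x t) ≤
        m (L k ∩ ball x t) + m ((A \ {x | 2 ^ k < 2 / φ x}) ∩ ball x t) := by
      refine (measure_mono ?_).trans (measure_union_le _ _)
      rw [← union_inter_distrib_right, inter_union_sdiff]
    have h4 : 2 ^ k * P (ball x t) ≤ 2 * m (L k ∩ ball x t) := by
      have hfin : 2 ^ k * P (ball x t) ≠ ⊤ := ENNReal.mul_ne_top (h2kt k) hPt
      refine (ENNReal.add_le_add_iff_right hfin).1 ?_
      calc 2 ^ k * P (ball x t) + 2 ^ k * P (ball x t) = 2 * (2 ^ k * P (ball x t)) := by ring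
        _ ≤ 2 * (m (L k ∩ ball x t) + m ((A \ {x | 2 ^ k < 2 / φ x}) ∩ ball x t)) := by
            gcongr; exact h1.le.trans h3
        _ ≤ _ := by rw [mul_add]; gcongr
    rw [Measure.restrict_apply isOpen_ball.measurableSet, inter_comm (ball x t),
      ← ENNReal.mul_div_right_comm, ENNReal.le_div_iff_mul_le (Or.inl (h2k0 k)) (Or.inl (h2kt k)),
      mul_comm]
    exact h4
  have hmeas : ∀ k : ℕ, Measurable fun x => if 2 ^ k < 2 / φ x then
      ((2 : ℝ≥0∞) ^ k) ^ (q - 1) else 0 := fun k =>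
    Measurable.ite (hmk k) measurable_const measurable_const
  have hterm : ∀ k : ℕ, ((2 : ℝ≥0∞) ^ (k + 1)) ^ q * (N * (2 / 2 ^ k * m (L k))) =
      N * 2 * 2 ^ q * ∫⁻ x in A, (if 2 ^ k < 2 / φ x then
        ((2 : ℝ≥0∞) ^ k) ^ (q - 1) else 0) ∂m := by
    intro k
    have e1 : ∫⁻ x in A, (if 2 ^ k < 2 / φ x then
        ((2 : ℝ≥0∞) ^ k) ^ (q - 1) else 0) ∂m = ((2 : ℝ≥0∞) ^ k) ^ (q - 1) * m (L k) := by
      have : (fun x => if 2 ^ k < 2 / φ x then ((2 : ℝ≥0∞) ^ k) ^ (q - 1) else 0) =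
          {x | 2 ^ k < 2 / φ x}.indicator fun _ => ((2 : ℝ≥0∞) ^ k) ^ (q - 1) := by
        ext x; simp [indicator]
      rw [this, lintegral_indicator_const (hmk k), Measure.restrict_apply (hmk k), inter_comm]
    have e2 : ((2 : ℝ≥0∞) ^ (k + 1)) ^ q * (2 / 2 ^ k) =
        2 * 2 ^ q * ((2 : ℝ≥0∞) ^ k) ^ (q - 1) := by
      rw [ENNReal.rpow_sub _ _ (h2k0 k) (h2kt k), ENNReal.rpow_one, pow_succ,
        ENNReal.mul_rpow_of_nonneg _ _ hq0.le]
      simp only [div_eq_mul_inv]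
      ring
    rw [e1]
    calc ((2 : ℝ≥0∞) ^ (k + 1)) ^ q * (N * (2 / 2 ^ k * m (L k)))
        = N * (((2 : ℝ≥0∞) ^ (k + 1)) ^ q * (2 / 2 ^ k)) * m (L k) := by ring
      _ = _ := by rw [e2]; ring
  have hdm : Measurable fun x => (2 / φ x) ^ (q - 1) := (measurable_const.div hφ).pow_const _
  have hfin : ∫⁻ x in A, (2 / φ x) ^ (q - 1) ∂m < ⊤ := by
    have : ∫⁻ x in A, (2 / φ x) ^ (q - 1) ∂m =
        2 ^ (q - 1) * ∫⁻ x in A, φ x ^ (-q) ∂P := by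
      rw [hP, setLIntegral_withDensity_eq_setLIntegral_mul m hφ (hφ.pow_const _) hA,
        ← lintegral_const_mul _ (hφ.mul (hφ.pow_const _))]
      refine setLIntegral_congr_fun hA fun x hx => ?_
      simp only [Pi.mul_apply]
      rw [div_eq_mul_inv, ENNReal.mul_rpow_of_nonneg _ _ (sub_pos.2 hq).le,
        ENNReal.inv_rpow, ← ENNReal.rpow_neg, neg_sub, sub_eq_add_neg 1 q,
        ENNReal.rpow_add _ _ (hA0 x hx) (hφt x), ENNReal.rpow_one]
    rw [this]
    exact ENNReal.mul_lt_top (ENNReal.rpow_lt_top_of_nonneg (sub_pos.2 hq).le (by simp)) hint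
  refine (lintegral_rpow_le_tsum_two_pow P _ hq0).trans_lt ?_
  refine ENNReal.add_lt_top.2 ⟨measure_lt_top _ _, ?_⟩
  calc ∑' k : ℕ, ((2 : ℝ≥0∞) ^ (k + 1)) ^ q *
        P {x | 2 ^ k < ⨆ t ∈ Ioc (0 : ℝ) T, m (A ∩ ball x t) / P (ball x t)}
      ≤ ∑' k : ℕ, ((2 : ℝ≥0∞) ^ (k + 1)) ^ q * (N * (2 / 2 ^ k * m (L k))) :=
        ENNReal.tsum_le_tsum fun k => by gcongr; exact hweak k
    _ = N * 2 * 2 ^ q * ∫⁻ x in A, ∑' k : ℕ, (if 2 ^ k < 2 / φ x then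
          ((2 : ℝ≥0∞) ^ k) ^ (q - 1) else 0) ∂m := by
        simp only [hterm]
        rw [ENNReal.tsum_mul_left, lintegral_tsum fun k => (hmeas k).aemeasurable]
    _ ≤ N * 2 * 2 ^ q * ∫⁻ x in A, D * (2 / φ x) ^ (q - 1) ∂m := by
        gcongr with x; exact hDle _
    _ = N * 2 * 2 ^ q * (D * ∫⁻ x in A, (2 / φ x) ^ (q - 1) ∂m) := by
        rw [lintegral_const_mul _ hdm]
    _ < ⊤ := by
        refine ENNReal.mul_lt_top (ENNReal.mul_lt_top (ENNReal.mul_lt_top ?_ ?_) ?_)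
          (ENNReal.mul_lt_top hD.lt_top hfin)
        · exact ENNReal.natCast_lt_top _
        · simp
        · exact ENNReal.rpow_lt_top_of_nonneg hq0.le (by simp)

section Geometry

variable {E : Type*} [NormedAddCommGroup E] [NormedSpace ℝ E] [FiniteDimensional ℝ E]
  [MeasurableSpace E] [BorelSpace E] (m : Measure E) [m.IsAddHaarMeasure]

theorem Convex.measure_inter_ball_mul_le {C : Set E} (hC : Convex ℝ C) {x : E} (hx : x ∈ C)
    {t T : ℝ} (ht : 0 < t) (htT : t ≤ T) :
    m (C ∩ ball x T) * m (ball x t) ≤ m (ball 0 T) * m (C ∩ ball x t) := by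
  have hT : 0 < T := ht.trans_le htT
  have hu : 0 < t / T := div_pos ht hT
  have hu1 : t / T ≤ 1 := (div_le_one hT).2 htT
  have hball : m (ball x t) = ENNReal.ofReal ((t / T) ^ Module.finrank ℝ E) * m (ball 0 T) := by
    rw [← Measure.addHaar_ball_mul_of_pos m x hu, div_mul_cancel₀ _ hT.ne']
  have himg : ENNReal.ofReal ((t / T) ^ Module.finrank ℝ E) * m (C ∩ ball x T) ≤
      m (C ∩ ball x t) := by
    have := Measure.addHaar_image_homothety m x (t / T) (C ∩ ball x T)
    rw [abs_of_pos (pow_pos hu _)] at this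
    rw [← this]
    refine measure_mono ?_
    rintro _ ⟨y, ⟨hyC, hyT⟩, rfl⟩
    refine ⟨?_, ?_⟩
    · rw [AffineMap.homothety_eq_lineMap]
      exact hC.lineMap_mem hx hyC ⟨hu.le, hu1⟩
    · rw [mem_ball, dist_homothety_center, Real.norm_of_nonneg hu.le]
      rw [mem_ball, dist_comm] at hyT
      calc t / T * dist x y < t / T * T := by gcongr
        _ = t := div_mul_cancel₀ _ hT.ne'
  calc m (C ∩ ball x T) * m (ball x t)
      = m (ball 0 T) * (ENNReal.ofReal ((t / T) ^ Module.finrank ℝ E) * m (C ∩ ball x T)) := by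
        rw [hball]; ring
    _ ≤ _ := by gcongr

theorem Convex.exists_ae_measure_ball_le {C : Set E} (hC : Convex ℝ C) (M T : ℝ) :
    ∃ κ : ℝ≥0∞, κ ≠ ⊤ ∧ ∀ᵐ x ∂m, x ∈ C → ‖x‖ ≤ M → ∀ t ∈ Ioc (0 : ℝ) T,
      m (ball x t) ≤ κ * m (C ∩ ball x t) := by
  by_cases h0 : m C = 0
  · refine ⟨0, by simp, ?_⟩
    filter_upwards [measure_eq_zero_iff_ae_notMem.1 h0] with x hx hx'
    exact absurd hx' hx
  obtain ⟨R, hR⟩ : ∃ R : ℕ, m (C ∩ ball 0 R) ≠ 0 := by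
    by_contra! h
    refine h0 ?_
    rw [← inter_univ C, ← iUnion_ball_nat (0 : E), inter_iUnion]
    exact measure_iUnion_null h
  have hRt : m (C ∩ ball 0 R) ≠ ⊤ :=
    ((measure_mono inter_subset_right).trans_lt measure_ball_lt_top).ne
  refine ⟨m (ball 0 (max T (M + R))) / m (C ∩ ball 0 R),
    ENNReal.div_ne_top measure_ball_lt_top.ne hR, ae_of_all _ fun x hx hxM t ht => ?_⟩
  rw [← ENNReal.mul_div_right_comm, ENNReal.le_div_iff_mul_le (Or.inl hR) (Or.inl hRt), mul_comm]
  refine le_trans ?_ (hC.measure_inter_ball_mul_le m hx ht.1 (ht.2.trans (le_max_left T (M + R))))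
  gcongr
  refine ball_subset_ball' ?_
  rw [dist_zero_left]
  exact le_max_of_le_right (by linarith)

theorem exists_ae_measure_ball_le_of_iUnion_convex {ι : Type*} [Fintype ι] {C : ι → Set E}
    (hC : ∀ i, Convex ℝ (C i)) (M T : ℝ) :
    ∃ κ : ℝ≥0∞, κ ≠ ⊤ ∧ ∀ᵐ x ∂m, x ∈ ⋃ i, C i → ‖x‖ ≤ M → ∀ t ∈ Ioc (0 : ℝ) T,
      m (ball x t) ≤ κ * m ((⋃ i, C i) ∩ ball x t) := by
  choose κ hκ hle using fun i => (hC i).exists_ae_measure_ball_le m M T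
  refine ⟨∑ i, κ i, ENNReal.sum_ne_top.2 fun i _ => hκ i, ?_⟩
  filter_upwards [ae_all_iff.2 hle] with x hx hxC hxM t ht
  obtain ⟨i, hi⟩ := mem_iUnion.1 hxC
  refine (hx i hi hxM t ht).trans ?_
  gcongr
  · exact Finset.single_le_sum (f := κ) (fun _ _ => zero_le) (Finset.mem_univ i)
  · exact subset_iUnion C i

end Geometry

section Homothety

variable {E : Type*} [NormedAddCommGroup E] [NormedSpace ℝ E] [FiniteDimensional ℝ E]
  [MeasurableSpace E] [BorelSpace E] (m : Measure E) [m.IsAddHaarMeasure]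

theorem map_inv_homothety_eq_smul {θ : ℝ} (hθ : 0 < θ) (a : E) :
    m.map (fun x => a + θ⁻¹ • (x - a)) = ENNReal.ofReal (θ ^ Module.finrank ℝ E) • m := by
  ext S hS
  rw [Measure.map_apply (by fun_prop) hS, Measure.smul_apply, smul_eq_mul,
    ← abs_of_pos (pow_pos hθ (Module.finrank ℝ E)), ← Measure.addHaar_image_homothety m a θ S]
  congr 1
  ext x
  simp only [mem_preimage, mem_image, AffineMap.homothety_apply, vsub_eq_sub, vadd_eq_add]
  constructor
  · intro hx
    exact ⟨_, hx, by simp [smul_smul, hθ.ne']⟩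
  · rintro ⟨y, hy, rfl⟩
    simpa [smul_smul, hθ.ne'] using hy

theorem map_inv_homothety_withDensity {θ : ℝ} (hθ : 0 < θ) (a : E) {φ : E → ℝ≥0∞}
    (hφ : Measurable φ) :
    (m.withDensity φ).map (fun x => a + θ⁻¹ • (x - a)) =
      ENNReal.ofReal (θ ^ Module.finrank ℝ E) •
        m.withDensity fun x => φ (a + θ • (x - a)) := by
  have hg : Measurable fun x : E => a + θ⁻¹ • (x - a) := by fun_prop
  have hh : Measurable fun x : E => φ (a + θ • (x - a)) := hφ.comp (by fun_prop)
  ext S hS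
  rw [Measure.map_apply hg hS, withDensity_apply _ (hg hS), Measure.smul_apply,
    withDensity_apply _ hS, ← lintegral_smul_measure,
    ← Measure.restrict_smul, ← map_inv_homothety_eq_smul m hθ a, setLIntegral_map hS hh hg]
  refine lintegral_congr fun x => ?_
  simp [smul_smul, hθ.ne']

end Homothety

theorem qdist_le_norm_add {d : ℕ} (x : EuclideanSpace ℝ (Fin d))
    (α : Finset (EuclideanSpace ℝ (Fin d))) : qdist x α ≤ qdist 0 α + ‖x‖ := by
  simpa [qdist] using
    infDist_le_infDist_add_dist (s := (α : Set (EuclideanSpace ℝ (Fin d)))) (x := x) (y := 0)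

theorem qdist_zero_le {d : ℕ} (x : EuclideanSpace ℝ (Fin d))
    (α : Finset (EuclideanSpace ℝ (Fin d))) : qdist 0 α ≤ qdist x α + ‖x‖ := by
  simpa [qdist] using
    infDist_le_infDist_add_dist (s := (α : Set (EuclideanSpace ℝ (Fin d)))) (x := 0) (y := x)

theorem ENNReal.add_rpow_le_two_rpow_mul {a b : ℝ≥0∞} {r : ℝ} (hr : 0 ≤ r) :
    (a + b) ^ r ≤ 2 ^ r * (a ^ r + b ^ r) := by
  calc (a + b) ^ r ≤ (2 * max a b) ^ r := by
        refine ENNReal.rpow_le_rpow ?_ hr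
        rw [two_mul]
        exact add_le_add (le_max_left _ _) (le_max_right _ _)
    _ = 2 ^ r * (max a b) ^ r := ENNReal.mul_rpow_of_nonneg _ _ hr
    _ ≤ _ := by
        gcongr
        rcases max_choice a b with h | h <;> rw [h]
        · exact le_self_add
        · exact le_add_self

/-- Optimal codebooks stay within bounded distance of the origin. -/
theorem OptimalSeq.exists_qdist_zero_le {d : ℕ} {P : Measure (EuclideanSpace ℝ (Fin d))}
    [IsProbabilityMeasure P] {r : ℝ} (hr : 0 < r)
    (hmom : ∫⁻ x, ENNReal.ofReal ‖x‖ ^ r ∂P ≠ ⊤)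
    {α : ℕ → Finset (EuclideanSpace ℝ (Fin d))} (hα : OptimalSeq P r α) :
    ∃ R : ℝ, ∀ n, 1 ≤ n → qdist 0 (α n) ≤ R := by
  set I := ∫⁻ x, ENNReal.ofReal ‖x‖ ^ r ∂P with hI
  have hqI : ∀ n, 1 ≤ n → qerr P r (α n) ≤ I := by
    intro n hn
    have h0 : qerr P r {0} = I := by simp [qerr, qdist, hI]
    rw [(hα n hn).2.2, ← h0]
    calc enr P r n ^ r ≤ (qerr P r {0} ^ (1 / r)) ^ r := by
          refine ENNReal.rpow_le_rpow ?_ hr.le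
          exact iInf_le_of_le {0} (iInf_le_of_le (Finset.singleton_nonempty 0)
            (iInf_le _ (by simpa using hn)))
      _ = qerr P r {0} := by rw [← ENNReal.rpow_mul, one_div_mul_cancel hr.ne', ENNReal.rpow_one]
  have hB : 2 ^ r * (I + I) ≠ ⊤ :=
    ENNReal.mul_ne_top (ENNReal.rpow_ne_top_of_nonneg hr.le (by simp))
      (ENNReal.add_ne_top.2 ⟨hmom, hmom⟩)
  refine ⟨((2 ^ r * (I + I)) ^ (1 / r)).toReal, fun n hn => ?_⟩
  have hmeas : Measurable fun x : EuclideanSpace ℝ (Fin d) => ENNReal.ofReal ‖x‖ ^ r := by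
    fun_prop
  have key : ENNReal.ofReal (qdist 0 (α n)) ^ r ≤ 2 ^ r * (I + I) := by
    calc ENNReal.ofReal (qdist 0 (α n)) ^ r
        = ∫⁻ _x, ENNReal.ofReal (qdist 0 (α n)) ^ r ∂P := by simp
      _ ≤ ∫⁻ x, 2 ^ r * (ENNReal.ofReal ‖x‖ ^ r + ENNReal.ofReal (qdist x (α n)) ^ r) ∂P := by
          refine lintegral_mono fun x => le_trans ?_ (ENNReal.add_rpow_le_two_rpow_mul hr.le)
          refine ENNReal.rpow_le_rpow ?_ hr.le
          rw [← ENNReal.ofReal_add (norm_nonneg x) (show 0 ≤ qdist x (α n) from infDist_nonneg)]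
          exact ENNReal.ofReal_le_ofReal ((qdist_zero_le x _).trans_eq (add_comm _ _))
      _ = 2 ^ r * (I + qerr P r (α n)) := by
          rw [lintegral_const_mul' _ _ (ENNReal.rpow_ne_top_of_nonneg hr.le (by simp)),
            lintegral_add_left hmeas]
          rfl
      _ ≤ 2 ^ r * (I + I) := by gcongr; exact hqI n hn
  refine (ENNReal.ofReal_le_iff_le_toReal
    (ENNReal.rpow_ne_top_of_nonneg (by positivity) hB)).1 ?_
  calc ENNReal.ofReal (qdist 0 (α n)) = (ENNReal.ofReal (qdist 0 (α n)) ^ r) ^ (1 / r) := by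
        rw [← ENNReal.rpow_mul, mul_one_div_cancel hr.ne', ENNReal.rpow_one]
    _ ≤ _ := ENNReal.rpow_le_rpow key (by positivity)

theorem lintegral_norm_rpow_ne_top_of_le {E : Type*} [NormedAddCommGroup E] [MeasurableSpace E]
    {P : Measure E} [IsFiniteMeasure P] {p p' : ℝ} (hp : 0 ≤ p) (hpp : p ≤ p')
    (h : ∫⁻ x, ENNReal.ofReal ‖x‖ ^ p' ∂P ≠ ⊤) : ∫⁻ x, ENNReal.ofReal ‖x‖ ^ p ∂P ≠ ⊤ := by
  refine ne_top_of_le_ne_top (b := P univ + ∫⁻ x, ENNReal.ofReal ‖x‖ ^ p' ∂P)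
    (ENNReal.add_ne_top.2 ⟨measure_ne_top _ _, h⟩) ?_
  calc ∫⁻ x, ENNReal.ofReal ‖x‖ ^ p ∂P
      ≤ ∫⁻ x, 1 + ENNReal.ofReal ‖x‖ ^ p' ∂P := by
        refine lintegral_mono fun x => ?_
        rcases le_total (ENNReal.ofReal ‖x‖) 1 with h1 | h1
        · exact (ENNReal.rpow_le_one h1 hp).trans le_self_add
        · exact (ENNReal.rpow_le_rpow_of_exponent_le h1 hpp).trans le_add_self
    _ = _ := by rw [lintegral_add_left measurable_const]; simp

theorem msupp_eq_support {d : ℕ} (P : Measure (EuclideanSpace ℝ (Fin d))) :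
    msupp P = P.support := by
  ext x
  exact nhds_basis_ball.mem_measureSupport.symm

section Dilation

variable {d : ℕ} {f : EuclideanSpace ℝ (Fin d) → ℝ} {θ : ℝ} {μ : EuclideanSpace ℝ (Fin d)}

theorem Admissible.ae_pos_of_fdil_pos (hadm : Admissible f θ μ) (hθ : 0 < θ) :
    ∀ᵐ x ∂(volume : Measure (EuclideanSpace ℝ (Fin d))), 0 < fdil f θ μ x → 0 < f x := by
  have hψ : Measurable fun x : EuclideanSpace ℝ (Fin d) => μ + θ • (x - μ) := by fun_prop
  have hmap := map_inv_homothety_eq_smul (volume : Measure (EuclideanSpace ℝ (Fin d)))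
    (inv_pos.2 hθ) μ
  rw [inv_inv] at hmap
  have hae : ∀ᵐ y ∂((volume : Measure (EuclideanSpace ℝ (Fin d))).map
      fun x => μ + θ • (x - μ)), 0 < f y → 0 < f (μ + θ⁻¹ • (y - μ)) := by
    rw [hmap]
    exact Measure.ae_smul_measure hadm _
  filter_upwards [ae_of_ae_map hψ.aemeasurable hae] with x hx h
  simpa [smul_smul, hθ.ne'] using hx h

/-- Under (H1) and admissibility, `P_{θ,μ}` is locally dominated by a multiple of `P`. -/
theorem Pdil_restrict_closedBall_le {P : Measure (EuclideanSpace ℝ (Fin d))}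
    (hf0 : ∀ x, 0 ≤ f x) (hfm : Measurable f)
    (hP : P = volume.withDensity fun x => ENNReal.ofReal (f x)) (hθ : 0 < θ)
    (hadm : Admissible f θ μ) (h1 : H1 f θ μ) {M : ℝ} (hM : 0 < M) :
    ∃ K : ℝ≥0∞, K ≠ ⊤ ∧ (Pdil P θ μ).restrict (closedBall 0 M) ≤ K • P := by
  obtain ⟨C, hC⟩ := h1 (M + 1) (by linarith)
  have hφ : Measurable fun x => ENNReal.ofReal (f x) := hfm.ennreal_ofReal
  have hle : ∀ᵐ x ∂(volume : Measure (EuclideanSpace ℝ (Fin d))), x ∈ closedBall 0 M →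
      ENNReal.ofReal (f (μ + θ • (x - μ))) ≤ ENNReal.ofReal C * ENNReal.ofReal (f x) := by
    filter_upwards [hadm.ae_pos_of_fdil_pos hθ] with x hx hxM
    rcases (hf0 x).eq_or_lt with h | h
    · have : f (μ + θ • (x - μ)) ≤ 0 := not_lt.1 fun h' => (hx h').ne h
      rw [ENNReal.ofReal_of_nonpos this]
      exact zero_le
    · rw [← ENNReal.ofReal_mul' h.le]
      refine ENNReal.ofReal_le_ofReal ((div_le_iff₀ h).1 (hC x ?_ h))
      exact closedBall_subset_ball (by linarith) hxM
  refine ⟨ENNReal.ofReal (θ ^ d) * ENNReal.ofReal C,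
    ENNReal.mul_ne_top ENNReal.ofReal_ne_top ENNReal.ofReal_ne_top, ?_⟩
  refine Measure.le_iff.2 fun S hS => ?_
  have hSB : MeasurableSet (S ∩ closedBall (0 : EuclideanSpace ℝ (Fin d)) M) :=
    hS.inter isClosed_closedBall.measurableSet
  rw [Measure.restrict_apply hS, Pdil, hP, map_inv_homothety_withDensity volume hθ μ hφ,
    finrank_euclideanSpace_fin, Measure.smul_apply, Measure.smul_apply, smul_eq_mul, smul_eq_mul,
    mul_assoc, withDensity_apply _ hSB, withDensity_apply _ hS, ← lintegral_const_mul _ hφ]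
  refine mul_le_mul' le_rfl ?_
  refine (setLIntegral_mono_ae (hφ.const_mul _).aemeasurable ?_).trans
    (lintegral_mono_set inter_subset_left)
  filter_upwards [hle] with x hx hxS using hx hxS.2

end Dilation

/-- Far from the origin `ψ_b` is controlled by the supremum in (H2). -/
theorem maxFun_le_iSup {d : ℕ} {P : Measure (EuclideanSpace ℝ (Fin d))}
    {α : ℕ → Finset (EuclideanSpace ℝ (Fin d))} {b T : ℝ} {x : EuclideanSpace ℝ (Fin d)}
    (h : ∀ n, 1 ≤ n → b * qdist x (α n) ≤ T) :
    maxFun P α b x ≤ ⨆ t ∈ Ioc (0 : ℝ) T, volume (ball x t) / P (ball x t) := by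
  refine iSup₂_le fun n hn => ?_
  rcases le_or_gt (b * qdist x (α n)) 0 with h0 | h0
  · simp [ball_eq_empty.2 h0]
  · exact le_iSup₂_of_le (b * qdist x (α n)) ⟨h0, h n hn⟩ le_rfl

theorem exists_ae_iSup_div_le {d : ℕ} {f : EuclideanSpace ℝ (Fin d) → ℝ}
    (hf0 : ∀ x, 0 ≤ f x) (hfm : Measurable f) {P : Measure (EuclideanSpace ℝ (Fin d))}
    (hP : P = volume.withDensity fun x => ENNReal.ofReal (f x)) (h3 : H3 P) (M T : ℝ) :
    ∃ κ : ℝ≥0∞, κ ≠ ⊤ ∧ ∀ᵐ x ∂P, ‖x‖ ≤ M →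
      (⨆ t ∈ Ioc (0 : ℝ) T, volume (ball x t) / P (ball x t)) ≤
        κ * ⨆ t ∈ Ioc (0 : ℝ) T,
          volume (({x | 0 < f x} ∩ closedBall 0 (M + T)) ∩ ball x t) / P (ball x t) := by
  obtain ⟨hac, k, C, hC, hCu⟩ := h3
  obtain ⟨κ, hκ, hκle⟩ := exists_ae_measure_ball_le_of_iUnion_convex
    (volume : Measure (EuclideanSpace ℝ (Fin d))) (fun i => (hC i).2) M T
  rw [← hCu] at hκle
  have hPv : P ≪ volume := hP ▸ withDensity_absolutelyContinuous _ _
  have hpos : ∀ᵐ x ∂P, 0 < f x := by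
    rw [hP, ae_withDensity_iff hfm.ennreal_ofReal]
    exact ae_of_all _ fun x hx => (hf0 x).lt_of_ne fun h => hx (by simp [← h])
  have hsupp : MeasurableSet (msupp P) := by
    rw [msupp_eq_support]; exact Measure.isClosed_support.measurableSet
  have hpos' : ∀ᵐ x ∂(volume : Measure (EuclideanSpace ℝ (Fin d))), x ∈ msupp P → 0 < f x :=
    (ae_restrict_iff' hsupp).1 (hac.ae_le hpos)
  have hmem : ∀ᵐ x ∂P, x ∈ msupp P := by
    rw [msupp_eq_support]; exact Measure.support_mem_ae
  refine ⟨κ, hκ, ?_⟩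
  filter_upwards [hmem, hPv.ae_le hκle] with x hx hxκ hxM
  refine iSup₂_le fun t ht => ?_
  have hle : volume (msupp P ∩ ball x t) ≤
      volume (({x | 0 < f x} ∩ closedBall 0 (M + T)) ∩ ball x t) := by
    refine measure_mono_ae ?_
    filter_upwards [hpos'] with y hy hyS
    refine ⟨⟨hy hyS.1, ?_⟩, hyS.2⟩
    have h1 : dist y x < t := hyS.2
    rw [mem_closedBall, dist_zero_right]
    have h2 : ‖y‖ ≤ ‖x‖ + dist y x := by
      simpa [add_comm] using dist_triangle y x 0
    linarith [ht.2]
  calc volume (ball x t) / P (ball x t)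
      ≤ κ * volume (({x | 0 < f x} ∩ closedBall 0 (M + T)) ∩ ball x t) / P (ball x t) := by
        gcongr
        exact (hxκ hx hxM t ht).trans (by gcongr)
    _ = κ * (volume (({x | 0 < f x} ∩ closedBall 0 (M + T)) ∩ ball x t) / P (ball x t)) :=
        mul_div_assoc _ _ _
    _ ≤ _ := by
        gcongr
        exact le_iSup₂ (f := fun t (_ : t ∈ Ioc (0 : ℝ) T) =>
          volume (({x | 0 < f x} ∩ closedBall 0 (M + T)) ∩ ball x t) / P (ball x t)) t ht

/-- **Corollary 3.1 (b).**
Let `r > 0`, `s ∈ (r+d, ∞)`, `P = f·λ_d` with `E|X|^{r+η} < ∞`, let `(α_n)` be an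
`L^r(P)`-optimal sequence of quantizers, and let `(θ,μ)` be `P`-admissible
satisfying (H1), (H2) and (H3).  If `f^{-s/(r+d)}` is locally `P`-integrable,
then there exists `b ∈ (0,1/2)` with `∫ ψ_b^{s/(d+r)} dP_{θ,μ} < ∞`. -/
theorem stmt_6 {d : ℕ} (hd : 1 ≤ d) (r s : ℝ) (hr : 0 < r) (hs : 0 < s)
    (hs' : r + d < s)
    (f : EuclideanSpace ℝ (Fin d) → ℝ) (hf0 : ∀ x, 0 ≤ f x) (hfm : Measurable f)
    (P : Measure (EuclideanSpace ℝ (Fin d))) [IsProbabilityMeasure P]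
    (hP : P = volume.withDensity fun x => ENNReal.ofReal (f x))
    (η : ℝ) (hη : 0 < η)
    (hmom : (∫⁻ x, ENNReal.ofReal ‖x‖ ^ (r + η) ∂P) ≠ ⊤)
    (α : ℕ → Finset (EuclideanSpace ℝ (Fin d))) (hα : OptimalSeq P r α)
    (θ : ℝ) (hθ : 0 < θ) (μ : EuclideanSpace ℝ (Fin d))
    (hadm : Admissible f θ μ) (h1 : H1 f θ μ) (h2 : H2 P θ μ s r) (h3 : H3 P)
    (hloc : ∀ K : Set (EuclideanSpace ℝ (Fin d)), IsCompact K →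
      (∫⁻ x in K, ENNReal.ofReal (f x) ^ (-(s / (r + (d : ℝ)))) ∂P) < ⊤) :
    ∃ b ∈ Ioo (0 : ℝ) (1 / 2),
      (∫⁻ x, maxFun P α b x ^ (s / ((d : ℝ) + r)) ∂(Pdil P θ μ)) < ⊤ := by
  obtain ⟨b, hb, M, hM, hfar⟩ := h2
  have hmom' : ∫⁻ x, ENNReal.ofReal ‖x‖ ^ r ∂P ≠ ⊤ :=
    lintegral_norm_rpow_ne_top_of_le hr.le (by linarith) hmom
  obtain ⟨R, hR⟩ := hα.exists_qdist_zero_le hr hmom'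
  have hq1 : 1 < s / ((d : ℝ) + r) := (one_lt_div (by positivity)).2 (by linarith)
  set q := s / ((d : ℝ) + r) with hq
  have hq0 : 0 < q := zero_lt_one.trans hq1
  set M' := max M R
  have hM' : 0 < M' := lt_max_of_lt_left hM
  have hdist : ∀ x n, 1 ≤ n → qdist x (α n) ≤ M' + ‖x‖ := fun x n hn =>
    (qdist_le_norm_add x _).trans (by gcongr; exact (hR n hn).trans (le_max_right _ _))
  refine ⟨b, hb, ?_⟩
  rw [← lintegral_add_compl _ (isClosed_closedBall (x := 0) (ε := M')).measurableSet]
  refine ENNReal.add_lt_top.2 ⟨?_, ?_⟩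
  · set T := b * (M' + M')
    set A := {x | 0 < f x} ∩ closedBall (0 : EuclideanSpace ℝ (Fin d)) (M' + T) with hA
    obtain ⟨K, hK, hKle⟩ := Pdil_restrict_closedBall_le hf0 hfm hP hθ hadm h1 hM'
    obtain ⟨κ, hκ, hκle⟩ := exists_ae_iSup_div_le hf0 hfm hP h3 M' T
    have hAm : MeasurableSet A :=
      (measurableSet_lt measurable_const hfm).inter isClosed_closedBall.measurableSet
    have hint : ∫⁻ x in A, ENNReal.ofReal (f x) ^ (-q) ∂P < ⊤ := by
      refine (lintegral_mono_set inter_subset_right).trans_lt ?_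
      rw [hq, add_comm (d : ℝ) r]
      exact hloc _ (isCompact_closedBall _ _)
    have hfin := lintegral_maximal_rpow_lt_top volume P hfm.ennreal_ofReal
      (fun x => ENNReal.ofReal_ne_top) hP hAm
      (fun x hx => (ENNReal.ofReal_pos.2 hx.1).ne') hq1 hint T
    have hac : (Pdil P θ μ).restrict (closedBall 0 M') ≪ P :=
      Measure.absolutelyContinuous_of_le_smul hKle
    calc ∫⁻ x in closedBall 0 M', maxFun P α b x ^ q ∂(Pdil P θ μ)
        ≤ ∫⁻ x in closedBall 0 M', κ ^ q *
            (⨆ t ∈ Ioc (0 : ℝ) T, volume (A ∩ ball x t) / P (ball x t)) ^ q ∂(Pdil P θ μ) := by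
          refine lintegral_mono_ae ?_
          filter_upwards [hac.ae_le hκle,
            ae_restrict_mem isClosed_closedBall.measurableSet] with x hx hxM
          rw [mem_closedBall, dist_zero_right] at hxM
          rw [← ENNReal.mul_rpow_of_nonneg _ _ hq0.le]
          refine ENNReal.rpow_le_rpow ((maxFun_le_iSup fun n hn => ?_).trans (hx hxM)) hq0.le
          exact mul_le_mul_of_nonneg_left ((hdist x n hn).trans (by gcongr)) hb.1.le
      _ ≤ ∫⁻ x, κ ^ q *
            (⨆ t ∈ Ioc (0 : ℝ) T, volume (A ∩ ball x t) / P (ball x t)) ^ q ∂(K • P) :=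
          lintegral_mono' hKle le_rfl
      _ = K * (κ ^ q * ∫⁻ x,
            (⨆ t ∈ Ioc (0 : ℝ) T, volume (A ∩ ball x t) / P (ball x t)) ^ q ∂P) := by
          rw [lintegral_smul_measure, smul_eq_mul,
            lintegral_const_mul' _ _ (ENNReal.rpow_ne_top_of_nonneg hq0.le hκ)]
      _ < ⊤ := ENNReal.mul_lt_top hK.lt_top (ENNReal.mul_lt_top
          (ENNReal.rpow_lt_top_of_nonneg hq0.le hκ) hfin)
  · refine lt_of_le_of_lt ?_ hfar
    refine (setLIntegral_mono' isClosed_closedBall.measurableSet.compl fun x hx => ?_).trans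
      (lintegral_mono_set fun x hx => ?_)
    · rw [mem_compl_iff, mem_closedBall, dist_zero_right, not_le] at hx
      refine ENNReal.rpow_le_rpow (maxFun_le_iSup fun n hn => ?_) hq0.le
      have := hdist x n hn
      nlinarith [hb.1]
    · rw [mem_compl_iff, mem_closedBall, dist_zero_right, not_le] at hx
      exact (le_max_left _ _).trans_lt hx
end
end
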